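/- arXiv:math/0305123 — 4 statements merged into one kernel-verified Lean document; each statement's English description precedes it below -/
import Mathlib

section
/- Define Q_k(ρ) = (q^{2n};q²)_k q^{−nk} φ_ρ(q^{2k}) (these are the Al-Salam–Chihara polynomials Q_k(cos(hρ/2); q^n, q^n | q²)). Then for all k, m ∈ ℤ_{≥0}: (1/4π) ∫_0^{2π/h} Q_k(ρ) Q_m(ρ) dρ / |c(ρ)|² = δ_{km} · (q^{2n};q²)_k² / [h · (q^{2k+2};q²)_{n−1}]. -/
/-- The q²-shifted factorial `(a; q²)_m = ∏_{j=0}^{m-1} (1 − a q^{2j})`. -/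
noncomputable def qpochC (q : ℝ) (a : ℂ) (m : ℕ) : ℂ :=
  ∏ j ∈ Finset.range m, (1 - a * (q : ℂ) ^ (2 * j))

/-- The infinite q²-shifted factorial `(a; q²)_∞ = ∏_{j=0}^{∞} (1 − a q^{2j})`. -/
noncomputable def qpochCInf (q : ℝ) (a : ℂ) : ℂ :=
  ∏' j : ℕ, (1 - a * (q : ℂ) ^ (2 * j))

/-- `q^z = e^{z·ln q}` for complex `z`. -/
noncomputable def qcpow (q : ℝ) (z : ℂ) : ℂ := Complex.exp (z * Real.log q)

/-- The q-spherical function `φ_ρ(q^{2m})`. -/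
noncomputable def sphPhi (q : ℝ) (n : ℕ) (ρ : ℝ) (m : ℕ) : ℂ :=
  ∑ l ∈ Finset.range (m + 1),
    qpochC q (((q : ℂ) ^ (2 * m))⁻¹) l *
      qpochC q (qcpow q ((n : ℂ) + ρ * Complex.I)) l *
      qpochC q (qcpow q ((n : ℂ) - ρ * Complex.I)) l /
      (qpochC q ((q : ℂ) ^ (2 * n)) l * qpochC q ((q : ℂ) ^ 2) l) * (q : ℂ) ^ (2 * l)

/-- The q-spherical transform
`𝓕f(ρ) = (1 − q^{2n}) Σ_{k≥0} f(q^{2k}) φ_ρ(q^{2k}) q^{−2nk} (q^{2k+2};q²)_{n−1}`. -/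
noncomputable def sphT (q : ℝ) (n : ℕ) (f : ℕ → ℂ) (ρ : ℝ) : ℂ :=
  (1 - (q : ℂ) ^ (2 * n)) *
    ∑' k : ℕ, f k * sphPhi q n ρ k * ((q : ℂ) ^ (2 * n * k))⁻¹ *
      qpochC q ((q : ℂ) ^ (2 * k + 2)) (n - 1)

/-- The q-Harish-Chandra density
`1/|c(ρ)|² = (q^{2n};q²)_∞² (q^{2iρ};q²)_∞ (q^{−2iρ};q²)_∞
  / [(q^{n+iρ};q²)_∞² (q^{n−iρ};q²)_∞²]`. -/
noncomputable def cInv (q : ℝ) (n : ℕ) (ρ : ℝ) : ℂ :=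
  (qpochCInf q ((q : ℂ) ^ (2 * n))) ^ 2 *
    qpochCInf q (qcpow q (2 * ρ * Complex.I)) *
    qpochCInf q (qcpow q (-(2 * ρ * Complex.I))) /
    ((qpochCInf q (qcpow q ((n : ℂ) + ρ * Complex.I))) ^ 2 *
      (qpochCInf q (qcpow q ((n : ℂ) - ρ * Complex.I))) ^ 2)

/-- The Al-Salam–Chihara polynomials `Q_k(cos(hρ/2); q^n, q^n | q²)
  = (q^{2n};q²)_k q^{−nk} φ_ρ(q^{2k})`. -/
noncomputable def Qpoly (q : ℝ) (n k : ℕ) (ρ : ℝ) : ℂ :=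
  qpochC q ((q : ℂ) ^ (2 * n)) k * ((q : ℂ) ^ (n * k))⁻¹ * sphPhi q n ρ k

open Filter Topology

lemma qpochC_succ (q : ℝ) (a : ℂ) (m : ℕ) :
    qpochC q a (m + 1) = qpochC q a m * (1 - a * (q : ℂ) ^ (2 * m)) := by
  simp [qpochC, Finset.prod_range_succ]

lemma qpochC_zero (q : ℝ) (a : ℂ) : qpochC q a 0 = 1 := by simp [qpochC]

lemma qpochC_add (q : ℝ) (a : ℂ) (l m : ℕ) :
    qpochC q a (l + m) = qpochC q a l * qpochC q (a * (q : ℂ) ^ (2 * l)) m := by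
  simp only [qpochC, Finset.prod_range_add]
  congr 1
  refine Finset.prod_congr rfl fun j _ ↦ ?_
  ring

lemma qpochC_succ' (q : ℝ) (a : ℂ) (m : ℕ) :
    qpochC q a (m + 1) = (1 - a) * qpochC q (a * (q : ℂ) ^ 2) m := by
  rw [add_comm, qpochC_add]; simp [qpochC]

section

variable {q : ℝ} (hq0 : 0 < q) (hq1 : q < 1)
include hq0 hq1

lemma summable_pow_two_mul : Summable fun j : ℕ ↦ q ^ (2 * j) := by
  simp_rw [pow_mul]
  exact summable_geometric_of_lt_one (by positivity) (by nlinarith)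

lemma summable_norm_neg_mul_pow (a : ℂ) :
    Summable fun j : ℕ ↦ ‖-(a * (q : ℂ) ^ (2 * j))‖ := by
  simpa [abs_of_pos hq0] using (summable_pow_two_mul hq0 hq1).mul_left ‖a‖

lemma multipliable_qpochC (a : ℂ) : Multipliable fun j : ℕ ↦ 1 - a * (q : ℂ) ^ (2 * j) := by
  simpa [sub_eq_add_neg] using
    multipliable_one_add_of_summable (summable_norm_neg_mul_pow hq0 hq1 a)

lemma tendsto_qpochC (a : ℂ) : Tendsto (qpochC q a) atTop (𝓝 (qpochCInf q a)) :=
  (multipliable_qpochC hq0 hq1 a).tendsto_prod_tprod_nat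

lemma qpochCInf_eq_mul (a : ℂ) (m : ℕ) :
    qpochCInf q a = qpochC q a m * qpochCInf q (a * (q : ℂ) ^ (2 * m)) := by
  refine tendsto_nhds_unique ((tendsto_add_atTop_iff_nat m).2 (tendsto_qpochC hq0 hq1 a)) ?_
  simp_rw [add_comm _ m, qpochC_add]
  exact (tendsto_qpochC hq0 hq1 _).const_mul _

lemma qpochCInf_eq_one_sub_mul (a : ℂ) :
    qpochCInf q a = (1 - a) * qpochCInf q (a * (q : ℂ) ^ 2) := by
  simpa [qpochC] using qpochCInf_eq_mul hq0 hq1 a 1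

lemma norm_mul_pow_lt_one {a : ℂ} (ha : ‖a‖ < 1) (j : ℕ) : ‖a * (q : ℂ) ^ j‖ < 1 := by
  rw [norm_mul, norm_pow, Complex.norm_real, Real.norm_of_nonneg hq0.le]
  exact mul_lt_one_of_nonneg_of_lt_one_left (norm_nonneg _) ha (pow_le_one₀ hq0.le hq1.le)

lemma one_sub_mul_pow_ne_zero {a : ℂ} (ha : ‖a‖ < 1) (j : ℕ) : 1 - a * (q : ℂ) ^ j ≠ 0 := by
  intro h
  have := norm_mul_pow_lt_one hq0 hq1 ha j
  rw [← sub_eq_zero.1 h] at this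
  simp at this

lemma qpochC_ne_zero {a : ℂ} (ha : ‖a‖ < 1) (m : ℕ) : qpochC q a m ≠ 0 :=
  Finset.prod_ne_zero_iff.2 fun _ _ ↦ one_sub_mul_pow_ne_zero hq0 hq1 ha _

lemma qpochCInf_ne_zero {a : ℂ} (ha : ‖a‖ < 1) : qpochCInf q a ≠ 0 := by
  have := tprod_one_add_ne_zero_of_summable (f := fun j : ℕ ↦ -(a * (q : ℂ) ^ (2 * j)))
    (fun j ↦ by simpa [← sub_eq_add_neg] using one_sub_mul_pow_ne_zero hq0 hq1 ha (2 * j))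
    (summable_norm_neg_mul_pow hq0 hq1 a)
  simpa [← sub_eq_add_neg] using! this

lemma differentiable_qpochCInf : Differentiable ℂ (qpochCInf q) := by
  intro a
  have hU : IsOpen (Metric.ball (0 : ℂ) (‖a‖ + 1)) := Metric.isOpen_ball
  have h := ((summable_pow_two_mul hq0 hq1).mul_left (‖a‖ + 1)).hasProdLocallyUniformlyOn_nat_one_add
    (f := fun j (x : ℂ) ↦ -(x * (q : ℂ) ^ (2 * j))) hU
    (.of_forall fun j x hx ↦ by
      have hx : ‖x‖ < ‖a‖ + 1 := by simpa using hx
      simp only [norm_neg, norm_mul, norm_pow, Complex.norm_real, Real.norm_of_nonneg hq0.le]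
      gcongr) (fun j ↦ by fun_prop)
  have h2 := h.differentiableOn (.of_forall fun _ ↦ by
    simpa [Finset.prod_fn] using DifferentiableOn.finsetProd (fun _ _ ↦ by fun_prop)) hU
  have h3 := h2.differentiableAt (hU.mem_nhds (x := a) (by simp))
  simpa [← sub_eq_add_neg] using! h3

lemma exists_norm_qpochC_le :
    ∃ B : ℝ, ∀ (a : ℂ) (m : ℕ), ‖a‖ ≤ 1 → ‖qpochC q a m‖ ≤ B := by
  have hs := summable_pow_two_mul hq0 hq1
  refine ⟨Real.exp (∑' j : ℕ, q ^ (2 * j)), fun a m ha ↦ ?_⟩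
  calc ‖qpochC q a m‖ ≤ ∏ j ∈ Finset.range m, Real.exp (q ^ (2 * j)) := by
        rw [qpochC, norm_prod]
        refine Finset.prod_le_prod (fun _ _ ↦ norm_nonneg _) fun j _ ↦ ?_
        have h1 : ‖a * (q : ℂ) ^ (2 * j)‖ ≤ q ^ (2 * j) := by
          rw [norm_mul, norm_pow, Complex.norm_real, Real.norm_of_nonneg hq0.le]
          exact mul_le_of_le_one_left (by positivity) ha
        have h2 := norm_sub_le 1 (a * (q : ℂ) ^ (2 * j))
        have h3 := Real.add_one_le_exp (q ^ (2 * j))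
        rw [norm_one] at h2
        linarith
    _ = Real.exp (∑ j ∈ Finset.range m, q ^ (2 * j)) := (Real.exp_sum _ _).symm
    _ ≤ _ := Real.exp_le_exp.2 (hs.sum_le_tsum _ fun _ _ ↦ by positivity)

end

/-- The integral over the angle of a function on the unit circle. -/
noncomputable def angleIntegral (f : ℂ → ℂ) : ℂ :=
  ∫ θ in (0 : ℝ)..(2 * Real.pi), f (circleMap 0 1 θ)

lemma circleMap_zero_one_neg (θ : ℝ) : circleMap 0 1 (-θ) = (circleMap 0 1 θ)⁻¹ := by
  simp [circleMap, ← Complex.exp_neg]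

lemma angleIntegral_congr {f g : ℂ → ℂ} (h : ∀ z : ℂ, ‖z‖ = 1 → f z = g z) :
    angleIntegral f = angleIntegral g :=
  intervalIntegral.integral_congr fun θ _ ↦ h _ (by simp)

lemma angleIntegral_comp_inv (f : ℂ → ℂ) :
    angleIntegral (fun z ↦ f z⁻¹) = angleIntegral f := by
  have h := (Function.Periodic.comp (periodic_circleMap 0 1) f).intervalIntegral_add_eq
    (-(2 * Real.pi)) 0
  simp only [neg_add_cancel, zero_add, Function.comp_apply] at h
  rw [angleIntegral, angleIntegral, ← h]
  simp_rw [← circleMap_zero_one_neg]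
  rw [intervalIntegral.integral_comp_neg (fun θ ↦ f (circleMap 0 1 θ)), neg_zero]

lemma angleIntegrable {f : ℂ → ℂ} (hf : ContinuousOn f (Metric.sphere 0 1)) :
    IntervalIntegrable (fun θ ↦ f (circleMap 0 1 θ)) MeasureTheory.volume 0 (2 * Real.pi) :=
  (hf.comp_continuous (continuous_circleMap 0 1) fun θ ↦
    circleMap_mem_sphere 0 zero_le_one θ).intervalIntegrable _ _

lemma angleIntegral_const_mul (c : ℂ) (f : ℂ → ℂ) :
    angleIntegral (fun z ↦ c * f z) = c * angleIntegral f :=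
  intervalIntegral.integral_const_mul _ _

lemma angleIntegral_add {f g : ℂ → ℂ} (hf : ContinuousOn f (Metric.sphere 0 1))
    (hg : ContinuousOn g (Metric.sphere 0 1)) :
    angleIntegral (fun z ↦ f z + g z) = angleIntegral f + angleIntegral g :=
  intervalIntegral.integral_add (angleIntegrable hf) (angleIntegrable hg)

lemma angleIntegral_sub {f g : ℂ → ℂ} (hf : ContinuousOn f (Metric.sphere 0 1))
    (hg : ContinuousOn g (Metric.sphere 0 1)) :
    angleIntegral (fun z ↦ f z - g z) = angleIntegral f - angleIntegral g :=
  intervalIntegral.integral_sub (angleIntegrable hf) (angleIntegrable hg)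

lemma angleIntegral_sum {ι : Type*} (s : Finset ι) {f : ι → ℂ → ℂ}
    (hf : ∀ i ∈ s, ContinuousOn (f i) (Metric.sphere 0 1)) :
    angleIntegral (fun z ↦ ∑ i ∈ s, f i z) = ∑ i ∈ s, angleIntegral (f i) :=
  intervalIntegral.integral_finsetSum fun i hi ↦ angleIntegrable (hf i hi)

/-- Bounded convergence on the unit circle. -/
lemma tendsto_angleIntegral {F : ℕ → ℂ → ℂ} {f : ℂ → ℂ} {C : ℝ}
    (hF : ∀ N, ContinuousOn (F N) (Metric.sphere 0 1))
    (hC : ∀ N (z : ℂ), ‖z‖ = 1 → ‖F N z‖ ≤ C)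
    (hlim : ∀ z : ℂ, ‖z‖ = 1 → Tendsto (fun N ↦ F N z) atTop (𝓝 (f z))) :
    Tendsto (fun N ↦ angleIntegral (F N)) atTop (𝓝 (angleIntegral f)) :=
  intervalIntegral.tendsto_integral_filter_of_dominated_convergence (fun _ ↦ C)
    (.of_forall fun N ↦ (angleIntegrable (hF N)).def'.aestronglyMeasurable)
    (.of_forall fun N ↦ .of_forall fun θ _ ↦ hC N _ (by simp))
    intervalIntegrable_const
    (.of_forall fun θ _ ↦ hlim _ (by simp))

lemma circleIntegral_inv_mul_eq {R : ℝ} (hR : 0 < R) (f : ℂ → ℂ) :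
    (∮ z in C(0, R), z⁻¹ * f z) = Complex.I * angleIntegral (fun z ↦ f (R * z)) := by
  rw [circleIntegral, angleIntegral, ← intervalIntegral.integral_const_mul]
  refine intervalIntegral.integral_congr fun θ _ ↦ ?_
  have h : circleMap 0 R θ ≠ 0 := circleMap_ne_center hR.ne'
  have h2 : circleMap 0 R θ = R * circleMap 0 1 θ := by simp [circleMap]
  simp only [deriv_circleMap, smul_eq_mul, ← h2]
  field_simp

/-- Shift of the contour between two circles centred at the origin. -/
lemma angleIntegral_shift {r R : ℝ} (hr : 0 < r) (hrR : r ≤ R) {f : ℂ → ℂ}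
    (hf : ∀ z : ℂ, r ≤ ‖z‖ → ‖z‖ ≤ R → DifferentiableAt ℂ f z) :
    angleIntegral (fun z ↦ f (R * z)) = angleIntegral (fun z ↦ f (r * z)) := by
  have key := Complex.circleIntegral_eq_of_differentiable_on_annulus_off_countable (c := 0)
    (f := fun z ↦ z⁻¹ * f z) hr hrR Set.countable_empty ?_ ?_
  · rw [circleIntegral_inv_mul_eq hr, circleIntegral_inv_mul_eq (hr.trans_le hrR)] at key
    exact mul_left_cancel₀ Complex.I_ne_zero key
  all_goals
    have hd : ∀ z : ℂ, r ≤ ‖z‖ → ‖z‖ ≤ R → DifferentiableAt ℂ (fun z ↦ z⁻¹ * f z) z := by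
      intro z h1 h2
      exact (differentiableAt_inv (norm_pos_iff.1 (hr.trans_le h1))).mul (hf z h1 h2)
  · rintro z ⟨h1, h2⟩
    simp only [Metric.mem_closedBall, dist_zero_right, Metric.mem_ball, not_lt] at h1 h2
    exact (hd z h2 h1).continuousAt.continuousWithinAt
  · rintro z ⟨⟨h1, h2⟩, -⟩
    simp only [Metric.mem_closedBall, dist_zero_right, Metric.mem_ball, not_le] at h1 h2
    exact hd z h2.le h1.le

/-- The mean value property at the centre of the unit disc. -/
lemma angleIntegral_of_differentiable {f : ℂ → ℂ} (hf : Differentiable ℂ f) :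
    angleIntegral f = 2 * Real.pi * f 0 := by
  have h := circleIntegral_inv_mul_eq one_pos f
  have h2 := hf.diffContOnCl.circleIntegral_sub_inv_smul (c := 0) (R := 1) (w := 0) (by simp)
  simp only [sub_zero, smul_eq_mul] at h2
  rw [h2] at h
  simp only [Complex.ofReal_one, one_mul] at h
  refine mul_left_cancel₀ Complex.I_ne_zero ?_
  rw [← h]; ring

lemma differentiable_qpochC (q : ℝ) (m : ℕ) : Differentiable ℂ (fun a ↦ qpochC q a m) := by
  unfold qpochC; fun_prop

lemma continuousOn_qpochC_comp (q : ℝ) (m : ℕ) {f : ℂ → ℂ} {s : Set ℂ} (hf : ContinuousOn f s) :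
    ContinuousOn (fun z ↦ qpochC q (f z) m) s :=
  (differentiable_qpochC q m).continuous.comp_continuousOn hf

lemma continuousOn_inv_sphere : ContinuousOn (fun z : ℂ ↦ z⁻¹) (Metric.sphere 0 1) :=
  continuousOn_inv₀.mono fun z hz ↦ by
    have : ‖z‖ = 1 := by simpa using hz
    simp [← norm_pos_iff, this]

lemma qpochC_mul_qpochC_succ_succ (q : ℝ) {x y : ℂ} (hxy : x * y = (q : ℂ) ^ 2) (a b : ℕ) :
    qpochC q x (a + 1) * qpochC q y (b + 1) =
      qpochC q x (a + 1) * qpochC q y b + qpochC q x a * qpochC q y (b + 1) -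
        (1 - (q : ℂ) ^ (2 * (a + b + 1))) * (qpochC q x a * qpochC q y b) := by
  have h : (q : ℂ) ^ (2 * (a + b + 1)) = (x * y) * (q : ℂ) ^ (2 * a) * (q : ℂ) ^ (2 * b) := by
    rw [hxy]; ring
  rw [qpochC_succ, qpochC_succ, h]
  ring

/-- The constant term of `(x; q²)_a (q²/x; q²)_b` at `x = z²`. -/
lemma angleIntegral_qpochC_mul_qpochC (q : ℝ) (a b : ℕ) :
    angleIntegral (fun z ↦ qpochC q (z ^ 2) a * qpochC q ((q : ℂ) ^ 2 * z⁻¹ ^ 2) b) *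
      (qpochC q ((q : ℂ) ^ 2) a * qpochC q ((q : ℂ) ^ 2) b) =
    2 * Real.pi * qpochC q ((q : ℂ) ^ 2) (a + b) := by
  have hinv := continuousOn_inv_sphere
  have hcont : ∀ a b, ContinuousOn
      (fun z : ℂ ↦ qpochC q (z ^ 2) a * qpochC q ((q : ℂ) ^ 2 * z⁻¹ ^ 2) b)
      (Metric.sphere 0 1) := fun a b ↦
    (continuousOn_qpochC_comp q a (by fun_prop)).mul (continuousOn_qpochC_comp q b (by fun_prop))
  induction a generalizing b with
  | zero =>
    have h := angleIntegral_comp_inv (fun z ↦ qpochC q ((q : ℂ) ^ 2 * z ^ 2) b)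
    have hd : Differentiable ℂ (fun z : ℂ ↦ qpochC q ((q : ℂ) ^ 2 * z ^ 2) b) :=
      (differentiable_qpochC q b).comp (by fun_prop)
    rw [angleIntegral_of_differentiable hd] at h
    simp only [qpochC_zero, one_mul, h, zero_add]
    simp [qpochC]
  | succ a iha =>
    induction b with
    | zero =>
      simp only [qpochC_zero, mul_one]
      have hd : Differentiable ℂ (fun z : ℂ ↦ qpochC q (z ^ 2) (a + 1)) :=
        (differentiable_qpochC q (a + 1)).comp (by fun_prop)
      rw [angleIntegral_of_differentiable hd]
      simp [qpochC]
    | succ b ihb =>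
      have h1 : angleIntegral
            (fun z ↦ qpochC q (z ^ 2) (a + 1) * qpochC q ((q : ℂ) ^ 2 * z⁻¹ ^ 2) (b + 1)) =
          angleIntegral
            (fun z ↦ qpochC q (z ^ 2) (a + 1) * qpochC q ((q : ℂ) ^ 2 * z⁻¹ ^ 2) b) +
          angleIntegral
            (fun z ↦ qpochC q (z ^ 2) a * qpochC q ((q : ℂ) ^ 2 * z⁻¹ ^ 2) (b + 1)) -
          (1 - (q : ℂ) ^ (2 * (a + b + 1))) * angleIntegral
            (fun z ↦ qpochC q (z ^ 2) a * qpochC q ((q : ℂ) ^ 2 * z⁻¹ ^ 2) b) := by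
        rw [← angleIntegral_const_mul, ← angleIntegral_add (hcont _ _) (hcont _ _),
          ← angleIntegral_sub ((hcont _ _).fun_add (hcont _ _)) ((hcont _ _).const_mul _)]
        refine angleIntegral_congr fun z hz ↦ qpochC_mul_qpochC_succ_succ q ?_ a b
        have : z ≠ 0 := by simp [← norm_pos_iff, hz]
        field_simp
      have e1 := iha b
      have e2 := iha (b + 1)
      rw [h1]
      rw [show a + 1 + b = a + b + 1 by ring] at ihb
      rw [show a + (b + 1) = a + b + 1 by ring] at e2
      rw [show a + 1 + (b + 1) = a + b + 1 + 1 by ring]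
      rw [qpochC_succ q _ (a + b)] at *
      rw [qpochC_succ q _ a] at *
      rw [qpochC_succ q _ b] at *
      rw [qpochC_succ q _ (a + b + 1), qpochC_succ q _ (a + b)]
      linear_combination (1 - (q : ℂ) ^ 2 * (q : ℂ) ^ (2 * b)) * ihb +
        (1 - (q : ℂ) ^ 2 * (q : ℂ) ^ (2 * a)) * e2 -
        (1 - (q : ℂ) ^ (2 * (a + b + 1))) * (1 - (q : ℂ) ^ 2 * (q : ℂ) ^ (2 * a)) *
          (1 - (q : ℂ) ^ 2 * (q : ℂ) ^ (2 * b)) * e1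

lemma qpochC_inv_symm (q : ℝ) {x : ℂ} (hx : x ≠ 0) (N : ℕ) :
    qpochC q x (N + 1) * qpochC q x⁻¹ (N + 1) =
      qpochC q x (N + 1) * qpochC q ((q : ℂ) ^ 2 * x⁻¹) N +
        qpochC q x⁻¹ (N + 1) * qpochC q ((q : ℂ) ^ 2 * x) N := by
  rw [qpochC_succ' q x, qpochC_succ' q x⁻¹, mul_comm x⁻¹, mul_comm x]
  field_simp
  ring

section

variable {q : ℝ} (hq0 : 0 < q) (hq1 : q < 1)
include hq0 hq1

lemma norm_sq_lt_one : ‖(q : ℂ) ^ 2‖ < 1 := by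
  rw [norm_pow, Complex.norm_real, Real.norm_of_nonneg hq0.le]
  nlinarith

lemma angleIntegral_qpochC_sq (N : ℕ) :
    angleIntegral (fun z ↦ qpochC q (z ^ 2) (N + 1) * qpochC q (z⁻¹ ^ 2) (N + 1)) =
      4 * Real.pi * (qpochC q ((q : ℂ) ^ 2) (N + 1 + N) /
        (qpochC q ((q : ℂ) ^ 2) (N + 1) * qpochC q ((q : ℂ) ^ 2) N)) := by
  have hinv := continuousOn_inv_sphere
  have hcont : ContinuousOn
      (fun z : ℂ ↦ qpochC q (z ^ 2) (N + 1) * qpochC q ((q : ℂ) ^ 2 * z⁻¹ ^ 2) N)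
      (Metric.sphere 0 1) :=
    (continuousOn_qpochC_comp q _ (by fun_prop)).mul (continuousOn_qpochC_comp q _ (by fun_prop))
  have hcont' : ContinuousOn
      (fun z : ℂ ↦ qpochC q (z⁻¹ ^ 2) (N + 1) * qpochC q ((q : ℂ) ^ 2 * z⁻¹⁻¹ ^ 2) N)
      (Metric.sphere 0 1) :=
    (continuousOn_qpochC_comp q _ (by fun_prop)).mul
      (continuousOn_qpochC_comp q _ (by simp_rw [inv_inv]; fun_prop))
  have h1 : angleIntegral (fun z ↦ qpochC q (z ^ 2) (N + 1) * qpochC q (z⁻¹ ^ 2) (N + 1)) =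
      angleIntegral (fun z ↦ qpochC q (z ^ 2) (N + 1) * qpochC q ((q : ℂ) ^ 2 * z⁻¹ ^ 2) N +
        qpochC q (z⁻¹ ^ 2) (N + 1) * qpochC q ((q : ℂ) ^ 2 * z⁻¹⁻¹ ^ 2) N) := by
    refine angleIntegral_congr fun z hz ↦ ?_
    have : z ^ 2 ≠ 0 := by simp [← norm_pos_iff, hz]
    simpa [inv_pow] using qpochC_inv_symm q this N
  rw [h1, angleIntegral_add hcont hcont', angleIntegral_comp_inv
    (fun z : ℂ ↦ qpochC q (z ^ 2) (N + 1) * qpochC q ((q : ℂ) ^ 2 * z⁻¹ ^ 2) N)]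
  have h2 := angleIntegral_qpochC_mul_qpochC q (N + 1) N
  have n1 := qpochC_ne_zero hq0 hq1 (norm_sq_lt_one hq0 hq1) (N + 1)
  have n2 := qpochC_ne_zero hq0 hq1 (norm_sq_lt_one hq0 hq1) N
  rw [← eq_div_iff (mul_ne_zero n1 n2)] at h2
  rw [h2]
  ring

/-- The constant term of `(z²; q²)_∞ (z⁻²; q²)_∞`. -/
lemma angleIntegral_qpochCInf_sq :
    angleIntegral (fun z ↦ qpochCInf q (z ^ 2) * qpochCInf q (z⁻¹ ^ 2)) =
      4 * Real.pi / qpochCInf q ((q : ℂ) ^ 2) := by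
  obtain ⟨B, hB⟩ := exists_norm_qpochC_le hq0 hq1
  have hB0 : 0 ≤ B := (norm_nonneg _).trans (hB 0 0 (by simp))
  have hinv := continuousOn_inv_sphere
  have h1 : Tendsto (fun N : ℕ ↦
      angleIntegral (fun z ↦ qpochC q (z ^ 2) (N + 1) * qpochC q (z⁻¹ ^ 2) (N + 1))) atTop
      (𝓝 (angleIntegral (fun z ↦ qpochCInf q (z ^ 2) * qpochCInf q (z⁻¹ ^ 2)))) := by
    refine tendsto_angleIntegral (C := B * B) (fun N ↦ ?_) (fun N z hz ↦ ?_) fun z hz ↦ ?_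
    · exact (continuousOn_qpochC_comp q _ (by fun_prop)).mul
        (continuousOn_qpochC_comp q _ (by fun_prop))
    · rw [norm_mul]
      exact mul_le_mul (hB _ _ (by simp [hz])) (hB _ _ (by simp [hz])) (norm_nonneg _) hB0
    · exact ((tendsto_add_atTop_iff_nat 1).2 (tendsto_qpochC hq0 hq1 _)).mul
        ((tendsto_add_atTop_iff_nat 1).2 (tendsto_qpochC hq0 hq1 _))
  refine tendsto_nhds_unique h1 ?_
  simp_rw [angleIntegral_qpochC_sq hq0 hq1]
  have hE := qpochCInf_ne_zero hq0 hq1 (norm_sq_lt_one hq0 hq1)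
  have ht := tendsto_qpochC hq0 hq1 ((q : ℂ) ^ 2)
  have h2 := (ht.comp (tendsto_atTop_mono (fun N : ℕ ↦ (by omega : N ≤ N + 1 + N))
    tendsto_id)).div (((tendsto_add_atTop_iff_nat 1).2 ht).mul ht) (mul_ne_zero hE hE)
  convert h2.const_mul (4 * Real.pi : ℂ) using 2
  · simp
  · field_simp

end

/-- The Al-Salam–Chihara weight with parameters `a`, `b` in base `q²` at `cos θ = (z + z⁻¹) / 2`. -/
noncomputable def ascWeight (q : ℝ) (a b z : ℂ) : ℂ :=
  qpochCInf q (z ^ 2) * qpochCInf q (z⁻¹ ^ 2) /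
    (qpochCInf q (a * z) * qpochCInf q (a * z⁻¹) * (qpochCInf q (b * z) * qpochCInf q (b * z⁻¹)))

lemma ascWeight_comm (q : ℝ) (a b z : ℂ) : ascWeight q a b z = ascWeight q b a z := by
  rw [ascWeight, ascWeight, mul_comm (qpochCInf q (a * z) * _)]

section

variable {q : ℝ} (hq0 : 0 < q) (hq1 : q < 1)
include hq0 hq1

lemma continuousOn_qpochCInf_comp {f : ℂ → ℂ} {s : Set ℂ} (hf : ContinuousOn f s) :
    ContinuousOn (fun z ↦ qpochCInf q (f z)) s :=
  (differentiable_qpochCInf hq0 hq1).continuous.comp_continuousOn hf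

lemma continuousOn_ascWeight {a b : ℂ} (ha : ‖a‖ < 1) (hb : ‖b‖ < 1) :
    ContinuousOn (ascWeight q a b) (Metric.sphere 0 1) := by
  have hinv := continuousOn_inv_sphere
  have hc : ∀ {f : ℂ → ℂ}, ContinuousOn f (Metric.sphere 0 1) →
    ContinuousOn (fun z ↦ qpochCInf q (f z)) (Metric.sphere 0 1) :=
    fun h ↦ continuousOn_qpochCInf_comp hq0 hq1 h
  have hne : ∀ {c : ℂ}, ‖c‖ < 1 → ∀ z ∈ Metric.sphere (0 : ℂ) 1,
      qpochCInf q (c * z) * qpochCInf q (c * z⁻¹) ≠ 0 := fun hc z hz ↦ by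
    have hz : ‖z‖ = 1 := by simpa using hz
    exact mul_ne_zero (qpochCInf_ne_zero hq0 hq1 (by simpa [hz] using hc))
      (qpochCInf_ne_zero hq0 hq1 (by simpa [hz] using hc))
  exact ((hc (by fun_prop)).mul (hc (by fun_prop))).div
    (((hc (by fun_prop)).mul (hc (by fun_prop))).mul ((hc (by fun_prop)).mul (hc (by fun_prop))))
    fun z hz ↦ mul_ne_zero (hne ha z hz) (hne hb z hz)

lemma differentiableAt_qpochCInf_comp {f : ℂ → ℂ} {z : ℂ} (hf : DifferentiableAt ℂ f z) :
    DifferentiableAt ℂ (fun z ↦ qpochCInf q (f z)) z :=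
  (differentiable_qpochCInf hq0 hq1).differentiableAt.comp z hf

/-- The linear Al-Salam–Chihara polynomial is orthogonal to constants. -/
lemma angleIntegral_linear_mul_ascWeight {a b : ℂ} (ha : ‖a‖ < 1) (hb : ‖b‖ < 1) :
    angleIntegral (fun z ↦ (z + z⁻¹ - (a + b)) * ascWeight q a b z) = 0 := by
  have hqC : (q : ℂ) ≠ 0 := by exact_mod_cast hq0.ne'
  have hqinv : q ≤ q⁻¹ := hq1.le.trans (one_le_inv_iff₀.2 ⟨hq0, hq1.le⟩)
  have hinv := continuousOn_inv_sphere
  set K : ℂ → ℂ := fun z ↦ (z - z⁻¹) *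
    (qpochCInf q ((q : ℂ) ^ 2 * z ^ 2) * qpochCInf q ((q : ℂ) ^ 2 * z⁻¹ ^ 2)) /
      (qpochCInf q (a * q * z) * qpochCInf q (a * q * z⁻¹) *
        (qpochCInf q (b * q * z) * qpochCInf q (b * q * z⁻¹))) with hK
  have hKd : ∀ z : ℂ, q ≤ ‖z‖ → ‖z‖ ≤ q⁻¹ → DifferentiableAt ℂ K z := by
    intro z h1 h2
    have hz : z ≠ 0 := norm_pos_iff.1 (hq0.trans_le h1)
    have hi : DifferentiableAt ℂ (fun z : ℂ ↦ z⁻¹) z := differentiableAt_inv hz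
    have hd : ∀ {f : ℂ → ℂ}, DifferentiableAt ℂ f z →
      DifferentiableAt ℂ (fun z ↦ qpochCInf q (f z)) z :=
      fun h ↦ differentiableAt_qpochCInf_comp hq0 hq1 h
    have hne : ∀ {c : ℂ}, ‖c‖ < 1 →
        qpochCInf q (c * q * z) * qpochCInf q (c * q * z⁻¹) ≠ 0 := fun {c} hc ↦ by
      have e1 : q * ‖z‖ ≤ 1 := by
        calc q * ‖z‖ ≤ q * q⁻¹ := by gcongr
          _ = 1 := mul_inv_cancel₀ hq0.ne'
      have e2 : q * ‖z‖⁻¹ ≤ 1 := by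
        rw [← div_eq_mul_inv]; exact div_le_one_of_le₀ h1 (norm_nonneg _)
      refine mul_ne_zero (qpochCInf_ne_zero hq0 hq1 ?_) (qpochCInf_ne_zero hq0 hq1 ?_)
      · rw [norm_mul, norm_mul, Complex.norm_real, Real.norm_of_nonneg hq0.le, mul_assoc]
        exact mul_lt_one_of_nonneg_of_lt_one_left (norm_nonneg _) hc e1
      · rw [norm_mul, norm_mul, Complex.norm_real, Real.norm_of_nonneg hq0.le, mul_assoc, norm_inv]
        exact mul_lt_one_of_nonneg_of_lt_one_left (norm_nonneg _) hc e2
    exact ((differentiableAt_id.sub hi).mul ((hd (by fun_prop)).mul (hd (by fun_prop)))).div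
      (((hd (by fun_prop)).mul (hd (by fun_prop))).mul
        ((hd (by fun_prop)).mul (hd (by fun_prop)))) (mul_ne_zero (hne ha) (hne hb))
  have hshift := angleIntegral_shift hq0 hqinv hKd
  have hcont : ∀ r : ℝ, 0 < r → q ≤ r → r ≤ q⁻¹ →
      ContinuousOn (fun z : ℂ ↦ K (r * z)) (Metric.sphere 0 1) := by
    intro r hr h1 h2 z hz
    have hz : ‖z‖ = 1 := by simpa using hz
    have := hKd (r * z) (by simpa [hz, abs_of_pos hr] using h1)
      (by simpa [hz, abs_of_pos hr] using h2)
    exact (ContinuousAt.comp (f := fun z : ℂ ↦ (r : ℂ) * z) this.continuousAt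
      (by fun_prop)).continuousWithinAt
  have hpt : ∀ z : ℂ, ‖z‖ = 1 → (z + z⁻¹ - (a + b)) * ascWeight q a b z =
      q * (K ((q⁻¹ : ℝ) * z) - K (q * z)) := by
    intro z hz
    have hz0 : z ≠ 0 := by simp [← norm_pos_iff, hz]
    have hne : ∀ {c : ℂ}, ‖c‖ < 1 → 1 - c * z ≠ 0 ∧ qpochCInf q (c * z * (q : ℂ) ^ 2) ≠ 0 ∧
        1 - c * z⁻¹ ≠ 0 ∧ qpochCInf q (c * z⁻¹ * (q : ℂ) ^ 2) ≠ 0 := by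
      intro c hc
      have c1 : ‖c * z‖ < 1 := by simpa [hz] using hc
      have c2 : ‖c * z⁻¹‖ < 1 := by simpa [hz] using hc
      exact ⟨by simpa using one_sub_mul_pow_ne_zero hq0 hq1 c1 0,
        qpochCInf_ne_zero hq0 hq1 (norm_mul_pow_lt_one hq0 hq1 c1 2),
        by simpa using one_sub_mul_pow_ne_zero hq0 hq1 c2 0,
        qpochCInf_ne_zero hq0 hq1 (norm_mul_pow_lt_one hq0 hq1 c2 2)⟩
    obtain ⟨a1, a2, a3, a4⟩ := hne ha
    obtain ⟨b1, b2, b3, b4⟩ := hne hb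
    have E := qpochCInf_eq_one_sub_mul hq0 hq1
    have r1 : (q : ℂ) ^ 2 * ((q⁻¹ : ℝ) * z) ^ 2 = z ^ 2 := by
      push_cast; field_simp
    have r2 : (q : ℂ) ^ 2 * ((q⁻¹ : ℝ) * z)⁻¹ ^ 2 = z⁻¹ ^ 2 * (q : ℂ) ^ 2 * (q : ℂ) ^ 2 := by
      push_cast; field_simp
    have r3 : (q : ℂ) ^ 2 * (q * z) ^ 2 = z ^ 2 * (q : ℂ) ^ 2 * (q : ℂ) ^ 2 := by ring
    have r4 : (q : ℂ) ^ 2 * (q * z)⁻¹ ^ 2 = z⁻¹ ^ 2 := by field_simp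
    have s1 : ∀ c : ℂ, c * q * ((q⁻¹ : ℝ) * z) = c * z := fun c ↦ by push_cast; field_simp
    have s2 : ∀ c : ℂ, c * q * ((q⁻¹ : ℝ) * z)⁻¹ = c * z⁻¹ * (q : ℂ) ^ 2 := fun c ↦ by
      push_cast; field_simp
    have s3 : ∀ c : ℂ, c * q * (q * z) = c * z * (q : ℂ) ^ 2 := fun c ↦ by ring
    have s4 : ∀ c : ℂ, c * q * (q * z)⁻¹ = c * z⁻¹ := fun c ↦ by field_simp
    simp only [hK, ascWeight, r1, r2, r3, r4, s1, s2, s3, s4]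
    rw [E (a * z), E (a * z⁻¹), E (b * z), E (b * z⁻¹), E (z ^ 2), E (z ^ 2 * (q : ℂ) ^ 2),
      E (z⁻¹ ^ 2), E (z⁻¹ ^ 2 * (q : ℂ) ^ 2)]
    generalize qpochCInf q (z ^ 2 * (q : ℂ) ^ 2 * (q : ℂ) ^ 2) = X1
    generalize qpochCInf q (z⁻¹ ^ 2 * (q : ℂ) ^ 2 * (q : ℂ) ^ 2) = X2
    generalize qpochCInf q (a * z * (q : ℂ) ^ 2) = A1 at *
    generalize qpochCInf q (a * z⁻¹ * (q : ℂ) ^ 2) = A2 at *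
    generalize qpochCInf q (b * z * (q : ℂ) ^ 2) = B1 at *
    generalize qpochCInf q (b * z⁻¹ * (q : ℂ) ^ 2) = B2 at *
    have a1' : 1 - z * a ≠ 0 := mul_comm a z ▸ a1
    have b1' : 1 - z * b ≠ 0 := mul_comm b z ▸ b1
    have a3' : z - a ≠ 0 := fun h ↦ a3 (by rw [← sub_eq_zero.1 h, mul_inv_cancel₀ hz0, sub_self])
    have b3' : z - b ≠ 0 := fun h ↦ b3 (by rw [← sub_eq_zero.1 h, mul_inv_cancel₀ hz0, sub_self])
    push_cast
    field_simp
    ring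
  rw [angleIntegral_congr hpt, angleIntegral_const_mul,
    angleIntegral_sub (hcont _ (inv_pos.2 hq0) hqinv le_rfl) (hcont _ hq0 le_rfl hqinv), hshift,
    sub_self, mul_zero]

lemma ascWeight_mul_pow {a b z : ℂ} (ha : ‖a‖ < 1) (hz : ‖z‖ = 1) (l : ℕ) :
    ascWeight q (a * (q : ℂ) ^ (2 * l)) b z =
      qpochC q (a * z) l * qpochC q (a * z⁻¹) l * ascWeight q a b z := by
  have c1 : ‖a * z‖ < 1 := by simpa [hz] using ha
  have c2 : ‖a * z⁻¹‖ < 1 := by simpa [hz] using ha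
  have n1 := qpochC_ne_zero hq0 hq1 c1 l
  have n2 := qpochC_ne_zero hq0 hq1 c2 l
  rw [ascWeight, ascWeight, qpochCInf_eq_mul hq0 hq1 (a * z) l,
    qpochCInf_eq_mul hq0 hq1 (a * z⁻¹) l, mul_right_comm a _ z, mul_right_comm a _ z⁻¹]
  generalize qpochC q (a * z) l = x at *
  generalize qpochC q (a * z⁻¹) l = y at *
  simp only [div_eq_mul_inv, mul_inv]
  field_simp

lemma angleIntegral_ascWeight_mul_sq {a b : ℂ} (ha : ‖a‖ < 1) (hb : ‖b‖ < 1) :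
    angleIntegral (ascWeight q (a * (q : ℂ) ^ 2) b) =
      (1 - a * b) * angleIntegral (ascWeight q a b) := by
  have hinv := continuousOn_inv_sphere
  have hW := continuousOn_ascWeight hq0 hq1 ha hb
  have h : ∀ z : ℂ, ‖z‖ = 1 → ascWeight q (a * (q : ℂ) ^ 2) b z =
      (1 - a * b) * ascWeight q a b z - a * ((z + z⁻¹ - (a + b)) * ascWeight q a b z) := by
    intro z hz
    have hz0 : z ≠ 0 := by simp [← norm_pos_iff, hz]
    have := ascWeight_mul_pow hq0 hq1 (b := b) ha hz 1
    simp only [mul_one, qpochC, Finset.prod_range_one, mul_zero, pow_zero] at this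
    rw [this]
    field_simp
    ring
  rw [angleIntegral_congr h, angleIntegral_sub (by fun_prop) (by fun_prop),
    angleIntegral_const_mul, angleIntegral_const_mul,
    angleIntegral_linear_mul_ascWeight hq0 hq1 ha hb]
  ring

lemma angleIntegral_ascWeight_mul_pow {a b : ℂ} (ha : ‖a‖ < 1) (hb : ‖b‖ < 1) (l : ℕ) :
    angleIntegral (ascWeight q (a * (q : ℂ) ^ (2 * l)) b) =
      qpochC q (a * b) l * angleIntegral (ascWeight q a b) := by
  induction l with
  | zero => simp [qpochC]
  | succ l ih =>
    have := angleIntegral_ascWeight_mul_sq hq0 hq1 (norm_mul_pow_lt_one hq0 hq1 ha (2 * l)) hb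
    rw [show a * (q : ℂ) ^ (2 * (l + 1)) = a * (q : ℂ) ^ (2 * l) * (q : ℂ) ^ 2 by ring, this, ih,
      qpochC_succ]
    ring

lemma angleIntegral_ascWeight_mul_pow_mul_pow {a b : ℂ} (ha : ‖a‖ < 1) (hb : ‖b‖ < 1) (l m : ℕ) :
    angleIntegral (ascWeight q (a * (q : ℂ) ^ (2 * l)) (b * (q : ℂ) ^ (2 * m))) =
      qpochC q (a * b) (l + m) * angleIntegral (ascWeight q a b) := by
  have hcomm : ∀ c d : ℂ, ascWeight q c d = ascWeight q d c :=
    fun c d ↦ funext fun z ↦ ascWeight_comm q c d z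
  have ha' := norm_mul_pow_lt_one hq0 hq1 ha (2 * l)
  rw [hcomm, angleIntegral_ascWeight_mul_pow hq0 hq1 hb ha', hcomm b,
    angleIntegral_ascWeight_mul_pow hq0 hq1 ha hb, qpochC_add,
    show b * (a * (q : ℂ) ^ (2 * l)) = a * b * (q : ℂ) ^ (2 * l) by ring]
  ring

/-- The Al-Salam–Chihara integral. -/
lemma angleIntegral_ascWeight {a b : ℂ} (ha : ‖a‖ < 1) (hb : ‖b‖ < 1) :
    angleIntegral (ascWeight q a b) =
      4 * Real.pi / (qpochCInf q ((q : ℂ) ^ 2) * qpochCInf q (a * b)) := by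
  have hinv := continuousOn_inv_sphere
  obtain ⟨B, hB⟩ := exists_norm_qpochC_le hq0 hq1
  have hB0 : 0 ≤ B := (norm_nonneg _).trans (hB 0 0 (by simp))
  have hW := continuousOn_ascWeight hq0 hq1 ha hb
  obtain ⟨C, hC⟩ := (isCompact_sphere (0 : ℂ) 1).exists_bound_of_continuousOn hW
  have hab : ‖a * b‖ < 1 := by
    rw [norm_mul]; exact mul_lt_one_of_nonneg_of_lt_one_left (norm_nonneg _) ha hb.le
  have h1 : Tendsto (fun N : ℕ ↦ angleIntegral (fun z ↦
        qpochC q (a * z) N * qpochC q (a * z⁻¹) N * (qpochC q (b * z) N * qpochC q (b * z⁻¹) N) *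
        ascWeight q a b z)) atTop
      (𝓝 (angleIntegral (fun z ↦ qpochCInf q (z ^ 2) * qpochCInf q (z⁻¹ ^ 2)))) := by
    refine tendsto_angleIntegral (C := B * B * (B * B) * C) (fun N ↦ ?_) (fun N z hz ↦ ?_)
      fun z hz ↦ ?_
    · have hc : ∀ {f : ℂ → ℂ}, ContinuousOn f (Metric.sphere 0 1) →
        ContinuousOn (fun z ↦ qpochC q (f z) N) (Metric.sphere 0 1) :=
        fun h ↦ continuousOn_qpochC_comp q N h
      exact (((hc (by fun_prop)).mul (hc (by fun_prop))).mul
        ((hc (by fun_prop)).mul (hc (by fun_prop)))).mul hW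
    · simp only [norm_mul]
      have hCz := hC z (by simpa using hz)
      have e1 := hB (a * z) N (by simpa [hz] using ha.le)
      have e2 := hB (a * z⁻¹) N (by simpa [hz] using ha.le)
      have e3 := hB (b * z) N (by simpa [hz] using hb.le)
      have e4 := hB (b * z⁻¹) N (by simpa [hz] using hb.le)
      gcongr
    · have t := tendsto_qpochC hq0 hq1
      have ne : ∀ {c : ℂ}, ‖c‖ < 1 → qpochCInf q (c * z) * qpochCInf q (c * z⁻¹) ≠ 0 := fun hc ↦
        mul_ne_zero (qpochCInf_ne_zero hq0 hq1 (by simpa [hz] using hc))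
          (qpochCInf_ne_zero hq0 hq1 (by simpa [hz] using hc))
      convert (((t (a * z)).mul (t (a * z⁻¹))).mul ((t (b * z)).mul (t (b * z⁻¹)))).mul_const
        (ascWeight q a b z) using 2
      rw [ascWeight, mul_div_cancel₀ _ (mul_ne_zero (ne ha) (ne hb))]
  rw [angleIntegral_qpochCInf_sq hq0 hq1] at h1
  have h2 : ∀ N : ℕ, angleIntegral (fun z ↦
        qpochC q (a * z) N * qpochC q (a * z⁻¹) N * (qpochC q (b * z) N * qpochC q (b * z⁻¹) N) *
        ascWeight q a b z) = qpochC q (a * b) (N + N) * angleIntegral (ascWeight q a b) := by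
    intro N
    rw [← angleIntegral_ascWeight_mul_pow_mul_pow hq0 hq1 ha hb]
    refine angleIntegral_congr fun z hz ↦ ?_
    rw [ascWeight_mul_pow hq0 hq1 ha hz, ascWeight_comm q a (b * _),
      ascWeight_mul_pow hq0 hq1 hb hz, ascWeight_comm q b]
    ring
  simp_rw [h2] at h1
  have h3 := tendsto_nhds_unique h1 (((tendsto_qpochC hq0 hq1 (a * b)).comp
    (tendsto_atTop_mono (fun N : ℕ ↦ (by omega : N ≤ N + N)) tendsto_id)).mul_const _)
  have n1 := qpochCInf_ne_zero hq0 hq1 (norm_sq_lt_one hq0 hq1)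
  have n2 := qpochCInf_ne_zero hq0 hq1 hab
  rw [← div_div, h3, mul_div_cancel_left₀ _ n2]

end

/-- The coefficient `(q^{-2k}; q²)_l q^{2l} / (q²; q²)_l` of a terminating basic hypergeometric
series. -/
noncomputable def qcoeff (q : ℝ) (k l : ℕ) : ℂ :=
  qpochC q (((q : ℂ) ^ (2 * k))⁻¹) l * (q : ℂ) ^ (2 * l) / qpochC q ((q : ℂ) ^ 2) l

lemma qcoeff_zero (q : ℝ) (k : ℕ) : qcoeff q k 0 = 1 := by simp [qcoeff, qpochC]

section

variable {q : ℝ} (hq0 : 0 < q) (hq1 : q < 1)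
include hq0

lemma qcoeff_self_succ (k : ℕ) : qcoeff q k (k + 1) = 0 := by
  have hqC : (q : ℂ) ≠ 0 := by exact_mod_cast hq0.ne'
  rw [qcoeff, qpochC_succ, inv_mul_cancel₀ (pow_ne_zero _ hqC)]
  simp

lemma qpochC_inv_self (k : ℕ) :
    qpochC q (((q : ℂ) ^ (2 * k))⁻¹) k * (q : ℂ) ^ (2 * k) *
      ∏ j ∈ Finset.range k, (-(q : ℂ) ^ (2 * j)) = qpochC q ((q : ℂ) ^ 2) k := by
  have hqC : (q : ℂ) ≠ 0 := by exact_mod_cast hq0.ne'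
  have h1 : qpochC q (((q : ℂ) ^ (2 * k))⁻¹) k =
      ∏ j ∈ Finset.range k, (1 - ((q : ℂ) ^ (2 * (j + 1)))⁻¹) := by
    rw [← Finset.prod_range_reflect, qpochC]
    refine Finset.prod_congr rfl fun j hj ↦ ?_
    have hj := Finset.mem_range.1 hj
    have : (q : ℂ) ^ (2 * k) = (q : ℂ) ^ (2 * (k - 1 - j + 1)) * (q : ℂ) ^ (2 * j) := by
      rw [← pow_add]; congr 1; omega
    rw [this]
    field_simp
  rw [h1, pow_mul, ← Finset.card_range k, ← Finset.prod_const, Finset.card_range,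
    ← Finset.prod_mul_distrib, ← Finset.prod_mul_distrib, qpochC]
  refine Finset.prod_congr rfl fun j _ ↦ ?_
  field_simp
  ring

include hq1

lemma qcoeff_succ_succ (k l : ℕ) :
    qcoeff q (k + 1) (l + 1) =
      qcoeff q k (l + 1) - ((q : ℂ) ^ (2 * k))⁻¹ * qcoeff q k l := by
  have hqC : (q : ℂ) ≠ 0 := by exact_mod_cast hq0.ne'
  have hx : ((q : ℂ) ^ (2 * (k + 1)))⁻¹ * (q : ℂ) ^ 2 = ((q : ℂ) ^ (2 * k))⁻¹ := by
    field_simp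
    ring
  have n1 := qpochC_ne_zero hq0 hq1 (norm_sq_lt_one hq0 hq1) l
  have n2 := one_sub_mul_pow_ne_zero hq0 hq1 (norm_sq_lt_one hq0 hq1) (2 * l)
  rw [qcoeff, qcoeff, qcoeff, qpochC_succ' q (((q : ℂ) ^ (2 * (k + 1)))⁻¹), hx,
    qpochC_succ q (((q : ℂ) ^ (2 * k))⁻¹), qpochC_succ q ((q : ℂ) ^ 2)]
  generalize qpochC q ((q : ℂ) ^ 2) l = x at *
  generalize qpochC q (((q : ℂ) ^ (2 * k))⁻¹) l = y at *
  have e1 : (q : ℂ) ^ (2 * (k + 1)) = (q : ℂ) ^ (2 * k) * (q : ℂ) ^ 2 := by ring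
  have e2 : (q : ℂ) ^ (2 * (l + 1)) = (q : ℂ) ^ (2 * l) * (q : ℂ) ^ 2 := by ring
  have nk : (q : ℂ) ^ (2 * k) ≠ 0 := pow_ne_zero _ hqC
  rw [e1, e2]
  generalize (q : ℂ) ^ (2 * k) = u at *
  generalize (q : ℂ) ^ (2 * l) = v at *
  field_simp
  ring

lemma sum_qcoeff_succ (k : ℕ) (r : ℕ → ℂ) :
    ∑ l ∈ Finset.range (k + 2), qcoeff q (k + 1) l * r l =
      ∑ l ∈ Finset.range (k + 1), qcoeff q k l * r l -
        ((q : ℂ) ^ (2 * k))⁻¹ * ∑ l ∈ Finset.range (k + 1), qcoeff q k l * r (l + 1) := by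
  have h : ∑ l ∈ Finset.range (k + 2), qcoeff q k l * r l =
      ∑ l ∈ Finset.range (k + 1), qcoeff q k l * r l := by
    rw [Finset.sum_range_succ, qcoeff_self_succ hq0, zero_mul, add_zero]
  rw [← h, Finset.sum_range_succ', Finset.sum_range_succ' _ (k + 1)]
  simp_rw [qcoeff_succ_succ hq0 hq1, qcoeff_zero, sub_mul, Finset.sum_sub_distrib, Finset.mul_sum,
    mul_assoc]
  ring

lemma sum_qcoeff_mul_pow (k i : ℕ) :
    ∑ l ∈ Finset.range (k + 1), qcoeff q k l * (q : ℂ) ^ (2 * i * l) =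
      ∏ j ∈ Finset.range k, (1 - (q : ℂ) ^ (2 * i) * ((q : ℂ) ^ (2 * j))⁻¹) := by
  induction k with
  | zero => simp [qcoeff_zero]
  | succ k ih =>
    have : ∀ l : ℕ, qcoeff q k l * (q : ℂ) ^ (2 * i * (l + 1)) =
        (q : ℂ) ^ (2 * i) * (qcoeff q k l * (q : ℂ) ^ (2 * i * l)) := fun l ↦ by ring
    rw [sum_qcoeff_succ hq0 hq1]
    simp_rw [this]
    rw [← Finset.mul_sum, ih, Finset.prod_range_succ]
    ring

lemma sum_qcoeff_mul_pow_of_lt {k i : ℕ} (h : i < k) :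
    ∑ l ∈ Finset.range (k + 1), qcoeff q k l * (q : ℂ) ^ (2 * i * l) = 0 := by
  have hqC : (q : ℂ) ≠ 0 := by exact_mod_cast hq0.ne'
  rw [sum_qcoeff_mul_pow hq0 hq1]
  refine Finset.prod_eq_zero (Finset.mem_range.2 h) ?_
  rw [mul_inv_cancel₀ (pow_ne_zero _ hqC), sub_self]

lemma sum_qcoeff_mul_pow_self (k : ℕ) :
    ∑ l ∈ Finset.range (k + 1), qcoeff q k l * (q : ℂ) ^ (2 * k * l) =
      qpochC q ((q : ℂ) ^ 2) k := by
  have hqC : (q : ℂ) ≠ 0 := by exact_mod_cast hq0.ne'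
  rw [sum_qcoeff_mul_pow hq0 hq1, qpochC, ← Finset.prod_range_reflect]
  refine Finset.prod_congr rfl fun j hj ↦ ?_
  have hj := Finset.mem_range.1 hj
  have : (q : ℂ) ^ (2 * k) = (q : ℂ) ^ 2 * (q : ℂ) ^ (2 * j) * (q : ℂ) ^ (2 * (k - 1 - j)) := by
    rw [← pow_add, ← pow_add]; congr 1; omega
  rw [this, mul_inv_cancel_right₀ (pow_ne_zero _ hqC)]

lemma sum_qcoeff_mul_pow_mul_qpochC (b : ℂ) (k m i : ℕ) :
    (i + m < k → ∑ l ∈ Finset.range (k + 1), qcoeff q k l *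
      ((q : ℂ) ^ (2 * i * l) * qpochC q (b * (q : ℂ) ^ (2 * l)) m) = 0) ∧
    (i + m = k → ∑ l ∈ Finset.range (k + 1), qcoeff q k l *
      ((q : ℂ) ^ (2 * i * l) * qpochC q (b * (q : ℂ) ^ (2 * l)) m) =
        (∏ j ∈ Finset.range m, (-(b * (q : ℂ) ^ (2 * j)))) * qpochC q ((q : ℂ) ^ 2) k) := by
  induction m generalizing i with
  | zero =>
    simp only [qpochC_zero, mul_one, add_zero, Finset.prod_range_zero, one_mul]
    refine ⟨sum_qcoeff_mul_pow_of_lt hq0 hq1, ?_⟩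
    rintro rfl
    exact sum_qcoeff_mul_pow_self hq0 hq1 i
  | succ m ih =>
    have h : ∑ l ∈ Finset.range (k + 1), qcoeff q k l *
          ((q : ℂ) ^ (2 * i * l) * qpochC q (b * (q : ℂ) ^ (2 * l)) (m + 1)) =
        ∑ l ∈ Finset.range (k + 1), qcoeff q k l *
          ((q : ℂ) ^ (2 * i * l) * qpochC q (b * (q : ℂ) ^ (2 * l)) m) -
        b * (q : ℂ) ^ (2 * m) * ∑ l ∈ Finset.range (k + 1), qcoeff q k l *
          ((q : ℂ) ^ (2 * (i + 1) * l) * qpochC q (b * (q : ℂ) ^ (2 * l)) m) := by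
      rw [Finset.mul_sum, ← Finset.sum_sub_distrib]
      refine Finset.sum_congr rfl fun l _ ↦ ?_
      rw [qpochC_succ]
      ring
    refine ⟨fun hlt ↦ ?_, fun heq ↦ ?_⟩
    · rw [h, (ih i).1 (by omega), (ih (i + 1)).1 (by omega)]
      ring
    · rw [h, (ih i).1 (by omega), (ih (i + 1)).2 (by omega), Finset.prod_range_succ]
      ring

end

/-- The Al-Salam–Chihara polynomial with equal parameters `a`, in the normalization of a basic
hypergeometric series. -/
noncomputable def ascPoly (q : ℝ) (a : ℂ) (k : ℕ) (z : ℂ) : ℂ :=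
  ∑ l ∈ Finset.range (k + 1),
    qcoeff q k l / qpochC q (a * a) l * (qpochC q (a * z) l * qpochC q (a * z⁻¹) l)

lemma ascPoly_inv (q : ℝ) (a : ℂ) (k : ℕ) (z : ℂ) : ascPoly q a k z⁻¹ = ascPoly q a k z := by
  simp only [ascPoly, inv_inv]
  exact Finset.sum_congr rfl fun l _ ↦ by ring

lemma ascWeight_inv (q : ℝ) (a b z : ℂ) : ascWeight q a b z⁻¹ = ascWeight q a b z := by
  simp only [ascWeight, inv_inv]
  ring

lemma continuousOn_qpochC_pair (q : ℝ) (a : ℂ) (l : ℕ) :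
    ContinuousOn (fun z ↦ qpochC q (a * z) l * qpochC q (a * z⁻¹) l) (Metric.sphere 0 1) := by
  have hinv := continuousOn_inv_sphere
  exact (continuousOn_qpochC_comp q l (by fun_prop)).mul (continuousOn_qpochC_comp q l (by fun_prop))

lemma continuousOn_ascPoly (q : ℝ) (a : ℂ) (k : ℕ) :
    ContinuousOn (ascPoly q a k) (Metric.sphere 0 1) :=
  continuousOn_finsetSum _ fun l _ ↦ continuousOn_const.mul (continuousOn_qpochC_pair q a l)

section

variable {q : ℝ} (hq0 : 0 < q) (hq1 : q < 1)
include hq0 hq1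

lemma angleIntegral_qpochC_pair_mul {a : ℂ} (ha : ‖a‖ < 1) (l m : ℕ) :
    angleIntegral (fun z ↦ qpochC q (a * z) l * qpochC q (a * z⁻¹) l *
      (qpochC q (a * z) m * qpochC q (a * z⁻¹) m * ascWeight q a a z)) =
    qpochC q (a * a) (l + m) * angleIntegral (ascWeight q a a) := by
  rw [← angleIntegral_ascWeight_mul_pow_mul_pow hq0 hq1 ha ha]
  refine angleIntegral_congr fun z hz ↦ ?_
  rw [ascWeight_mul_pow hq0 hq1 ha hz, ascWeight_comm q a (a * _),
    ascWeight_mul_pow hq0 hq1 ha hz]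

lemma angleIntegral_ascPoly_mul_qpochC {a : ℂ} (ha : ‖a‖ < 1) (k m : ℕ) :
    angleIntegral (fun z ↦ qpochC q (a * z) m * qpochC q (a * z⁻¹) m *
      (ascPoly q a k z * ascWeight q a a z)) =
    (∑ l ∈ Finset.range (k + 1), qcoeff q k l * qpochC q (a * a * (q : ℂ) ^ (2 * l)) m) *
      angleIntegral (ascWeight q a a) := by
  have haa : ‖a * a‖ < 1 := by
    rw [norm_mul]; exact mul_lt_one_of_nonneg_of_lt_one_left (norm_nonneg _) ha ha.le
  have hW := continuousOn_ascWeight hq0 hq1 ha ha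
  have h : ∀ z : ℂ, ‖z‖ = 1 → qpochC q (a * z) m * qpochC q (a * z⁻¹) m *
      (ascPoly q a k z * ascWeight q a a z) = ∑ l ∈ Finset.range (k + 1),
        qcoeff q k l / qpochC q (a * a) l * (qpochC q (a * z) l * qpochC q (a * z⁻¹) l *
        (qpochC q (a * z) m * qpochC q (a * z⁻¹) m * ascWeight q a a z)) := by
    intro z _
    rw [ascPoly, Finset.sum_mul, Finset.mul_sum]
    exact Finset.sum_congr rfl fun l _ ↦ by ring
  have hc : ∀ l ∈ Finset.range (k + 1), ContinuousOn (fun z ↦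
      qcoeff q k l / qpochC q (a * a) l * (qpochC q (a * z) l * qpochC q (a * z⁻¹) l *
        (qpochC q (a * z) m * qpochC q (a * z⁻¹) m * ascWeight q a a z))) (Metric.sphere 0 1) :=
    fun l _ ↦ continuousOn_const.mul
      ((continuousOn_qpochC_pair q a l).mul ((continuousOn_qpochC_pair q a m).mul hW))
  rw [angleIntegral_congr h, angleIntegral_sum _ hc, Finset.sum_mul]
  refine Finset.sum_congr rfl fun l _ ↦ ?_
  rw [angleIntegral_const_mul, angleIntegral_qpochC_pair_mul hq0 hq1 ha, qpochC_add]
  have := qpochC_ne_zero hq0 hq1 haa l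
  generalize qpochC q (a * a) l = x at *
  field_simp

lemma angleIntegral_ascPoly_mul_ascPoly {a : ℂ} (ha : ‖a‖ < 1) (k m : ℕ) :
    angleIntegral (fun z ↦ ascPoly q a m z * (ascPoly q a k z * ascWeight q a a z)) =
    ∑ l ∈ Finset.range (m + 1), qcoeff q m l / qpochC q (a * a) l *
      angleIntegral (fun z ↦ qpochC q (a * z) l * qpochC q (a * z⁻¹) l *
        (ascPoly q a k z * ascWeight q a a z)) := by
  have hW := continuousOn_ascWeight hq0 hq1 ha ha
  have hc : ∀ l ∈ Finset.range (m + 1), ContinuousOn (fun z ↦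
      qcoeff q m l / qpochC q (a * a) l * (qpochC q (a * z) l * qpochC q (a * z⁻¹) l *
        (ascPoly q a k z * ascWeight q a a z))) (Metric.sphere 0 1) :=
    fun l _ ↦ continuousOn_const.mul
      ((continuousOn_qpochC_pair q a l).mul ((continuousOn_ascPoly q a k).mul hW))
  simp_rw [← angleIntegral_const_mul]
  rw [← angleIntegral_sum _ hc]
  refine angleIntegral_congr fun z _ ↦ ?_
  rw [ascPoly, Finset.sum_mul]
  exact Finset.sum_congr rfl fun l _ ↦ by ring

lemma angleIntegral_ascPoly_mul_qpochC_of_lt {a : ℂ} (ha : ‖a‖ < 1) {k m : ℕ} (h : m < k) :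
    angleIntegral (fun z ↦ qpochC q (a * z) m * qpochC q (a * z⁻¹) m *
      (ascPoly q a k z * ascWeight q a a z)) = 0 := by
  have := (sum_qcoeff_mul_pow_mul_qpochC hq0 hq1 (a * a) k m 0).1 (by omega)
  simp only [mul_zero, zero_mul, pow_zero, one_mul] at this
  rw [angleIntegral_ascPoly_mul_qpochC hq0 hq1 ha, this, zero_mul]

lemma angleIntegral_ascPoly_of_lt {a : ℂ} (ha : ‖a‖ < 1) {k m : ℕ} (h : m < k) :
    angleIntegral (fun z ↦ ascPoly q a m z * (ascPoly q a k z * ascWeight q a a z)) = 0 := by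
  rw [angleIntegral_ascPoly_mul_ascPoly hq0 hq1 ha]
  refine Finset.sum_eq_zero fun l hl ↦ ?_
  rw [angleIntegral_ascPoly_mul_qpochC_of_lt hq0 hq1 ha
    ((Nat.lt_succ_iff.1 (Finset.mem_range.1 hl)).trans_lt h), mul_zero]

lemma angleIntegral_ascPoly_of_ne {a : ℂ} (ha : ‖a‖ < 1) {k m : ℕ} (h : k ≠ m) :
    angleIntegral (fun z ↦ ascPoly q a m z * (ascPoly q a k z * ascWeight q a a z)) = 0 := by
  rcases h.lt_or_gt with h | h
  · rw [← angleIntegral_ascPoly_of_lt hq0 hq1 ha h]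
    exact angleIntegral_congr fun z _ ↦ by ring
  · exact angleIntegral_ascPoly_of_lt hq0 hq1 ha h

lemma angleIntegral_ascPoly_self {a : ℂ} (ha : ‖a‖ < 1) (k : ℕ) :
    angleIntegral (fun z ↦ ascPoly q a k z * (ascPoly q a k z * ascWeight q a a z)) =
      a ^ (2 * k) * qpochC q ((q : ℂ) ^ 2) k / qpochC q (a * a) k *
        angleIntegral (ascWeight q a a) := by
  have h := (sum_qcoeff_mul_pow_mul_qpochC hq0 hq1 (a * a) k k 0).2 (by omega)
  simp only [mul_zero, zero_mul, pow_zero, one_mul] at h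
  have hp : ∏ j ∈ Finset.range k, (-(a * a * (q : ℂ) ^ (2 * j))) =
      a ^ (2 * k) * ∏ j ∈ Finset.range k, (-(q : ℂ) ^ (2 * j)) := by
    rw [pow_mul, sq]
    simp_rw [← mul_neg]
    rw [Finset.prod_mul_distrib, Finset.prod_const, Finset.card_range]
  rw [angleIntegral_ascPoly_mul_ascPoly hq0 hq1 ha, Finset.sum_range_succ,
    Finset.sum_eq_zero fun l hl ↦ by
      rw [angleIntegral_ascPoly_mul_qpochC_of_lt hq0 hq1 ha (Finset.mem_range.1 hl), mul_zero],
    zero_add, angleIntegral_ascPoly_mul_qpochC hq0 hq1 ha, h, hp, qcoeff]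
  have n1 := qpochC_ne_zero hq0 hq1 (norm_sq_lt_one hq0 hq1) k
  rw [← qpochC_inv_self hq0 k] at n1 ⊢
  field_simp

/-- The change of variables from the spectral parameter `ρ` to the unit circle. -/
lemma integral_circleMap_mul_log {f : ℂ → ℂ} (hf : ContinuousOn f (Metric.sphere 0 1))
    (hinv : ∀ z, f z⁻¹ = f z) :
    ∫ ρ in (0 : ℝ)..(2 * Real.pi / Real.log ((q ^ 2)⁻¹)), f (circleMap 0 1 (ρ * Real.log q)) =
      angleIntegral f / (Real.log ((q ^ 2)⁻¹) : ℝ) := by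
  have hlog : Real.log q ≠ 0 := (Real.log_neg hq0 hq1).ne
  have hlog2 : Real.log ((q ^ 2)⁻¹) = -2 * Real.log q := by
    rw [Real.log_inv, Real.log_pow]; push_cast; ring
  have hint : ∀ s t : ℝ, IntervalIntegrable (fun θ ↦ f (circleMap 0 1 θ))
      MeasureTheory.volume s t := fun s t ↦
    (hf.comp_continuous (continuous_circleMap 0 1) fun θ ↦
      circleMap_mem_sphere 0 zero_le_one θ).intervalIntegrable _ _
  have h1 : ∫ θ in (0 : ℝ)..Real.pi, f (circleMap 0 1 θ) =
      ∫ θ in (-Real.pi)..0, f (circleMap 0 1 θ) := by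
    have := intervalIntegral.integral_comp_neg (a := 0) (b := Real.pi)
      (fun θ ↦ f (circleMap 0 1 θ))
    simpa [circleMap_zero_one_neg, hinv] using this
  have h2 : angleIntegral f = 2 * ∫ θ in (-Real.pi)..0, f (circleMap 0 1 θ) := by
    have h := (Function.Periodic.comp (periodic_circleMap 0 1) f).intervalIntegral_add_eq
      0 (-Real.pi)
    rw [zero_add, show -Real.pi + 2 * Real.pi = Real.pi by ring] at h
    simp only [Function.comp_apply] at h
    rw [angleIntegral, h, ← intervalIntegral.integral_add_adjacent_intervals (hint _ 0) (hint _ _),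
      h1]
    ring
  rw [intervalIntegral.integral_comp_mul_right (fun θ ↦ f (circleMap 0 1 θ)) hlog, hlog2, zero_mul,
    show 2 * Real.pi / (-2 * Real.log q) * Real.log q = -Real.pi by field_simp,
    intervalIntegral.integral_symm, h2, Complex.real_smul]
  have : (Real.log q : ℂ) ≠ 0 := by exact_mod_cast hlog
  push_cast
  field_simp

end

lemma qcpow_mul_I (q ρ : ℝ) : qcpow q (ρ * Complex.I) = circleMap 0 1 (ρ * Real.log q) := by
  simp only [qcpow, circleMap, Complex.ofReal_one, one_mul, zero_add, Complex.ofReal_mul]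
  ring_nf

lemma qcpow_add (q : ℝ) (x y : ℂ) : qcpow q (x + y) = qcpow q x * qcpow q y := by
  rw [qcpow, qcpow, qcpow, add_mul, Complex.exp_add]

lemma qcpow_neg (q : ℝ) (x : ℂ) : qcpow q (-x) = (qcpow q x)⁻¹ := by
  rw [qcpow, qcpow, neg_mul, Complex.exp_neg]

lemma qcpow_natCast {q : ℝ} (hq0 : 0 < q) (n : ℕ) : qcpow q n = (q : ℂ) ^ n := by
  rw [qcpow, Complex.exp_nat_mul, ← Complex.ofReal_exp, Real.exp_log hq0]

lemma Qpoly_eq {q : ℝ} (hq0 : 0 < q) (n k : ℕ) (ρ : ℝ) :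
    Qpoly q n k ρ = qpochC q ((q : ℂ) ^ n * (q : ℂ) ^ n) k * ((q : ℂ) ^ (n * k))⁻¹ *
      ascPoly q ((q : ℂ) ^ n) k (circleMap 0 1 (ρ * Real.log q)) := by
  rw [Qpoly, sphPhi, ascPoly, ← qcpow_mul_I, ← pow_add, ← two_mul]
  congr 1
  refine Finset.sum_congr rfl fun l _ ↦ ?_
  rw [qcoeff, sub_eq_add_neg, qcpow_add, qcpow_add, qcpow_neg, qcpow_natCast hq0]
  ring

lemma cInv_eq {q : ℝ} (hq0 : 0 < q) (n : ℕ) (ρ : ℝ) :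
    cInv q n ρ = qpochCInf q ((q : ℂ) ^ n * (q : ℂ) ^ n) ^ 2 *
      ascWeight q ((q : ℂ) ^ n) ((q : ℂ) ^ n) (circleMap 0 1 (ρ * Real.log q)) := by
  rw [cInv, ascWeight, ← qcpow_mul_I, ← pow_add, ← two_mul, sub_eq_add_neg, qcpow_add, qcpow_add,
    qcpow_neg, qcpow_neg, qcpow_natCast hq0, mul_assoc 2, two_mul (_ * Complex.I), qcpow_add]
  ring_nf

/-- Orthogonality relations for the Al-Salam–Chihara polynomials `Q_k`:
`(1/4π) ∫_0^{2π/h} Q_k(ρ) Q_m(ρ) dρ/|c(ρ)|²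
  = δ_{km} (q^{2n};q²)_k² / [h (q^{2k+2};q²)_{n−1}]`, where `h = log q^{−2}`. -/
theorem statement8 (q : ℝ) (hq0 : 0 < q) (hq1 : q < 1) (n : ℕ) (hn : 1 ≤ n)
    (k m : ℕ) :
    ((1 / (4 * Real.pi) : ℝ) : ℂ) *
      ∫ ρ in (0 : ℝ)..(2 * Real.pi / Real.log ((q ^ 2)⁻¹)),
        Qpoly q n k ρ * Qpoly q n m ρ * cInv q n ρ =
    (if k = m then 1 else 0) * (qpochC q ((q : ℂ) ^ (2 * n)) k) ^ 2 /
      (((Real.log ((q ^ 2)⁻¹) : ℝ) : ℂ) * qpochC q ((q : ℂ) ^ (2 * k + 2)) (n - 1)) := by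
  set a : ℂ := (q : ℂ) ^ n with ha_def
  have hqC : (q : ℂ) ≠ 0 := by exact_mod_cast hq0.ne'
  have ha0 : a ≠ 0 := pow_ne_zero _ hqC
  have ha : ‖a‖ < 1 := by
    rw [ha_def, norm_pow, Complex.norm_real, Real.norm_of_nonneg hq0.le]
    exact pow_lt_one₀ hq0.le hq1 (by omega)
  have haa : ‖a * a‖ < 1 := by
    rw [norm_mul]; exact mul_lt_one_of_nonneg_of_lt_one_left (norm_nonneg _) ha ha.le
  have h2n : (q : ℂ) ^ (2 * n) = a * a := by rw [ha_def]; ring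
  have hW := continuousOn_ascWeight hq0 hq1 ha ha
  have hcont := (continuousOn_ascPoly q a m).mul ((continuousOn_ascPoly q a k).mul hW)
  have hI := integral_circleMap_mul_log hq0 hq1 hcont
    fun z ↦ by simp only [Pi.mul_apply, ascPoly_inv, ascWeight_inv]
  have hρ : ∀ ρ : ℝ, Qpoly q n k ρ * Qpoly q n m ρ * cInv q n ρ =
      qpochC q (a * a) k * ((q : ℂ) ^ (n * k))⁻¹ * (qpochC q (a * a) m * ((q : ℂ) ^ (n * m))⁻¹) *
        qpochCInf q (a * a) ^ 2 *
        (ascPoly q a m * (ascPoly q a k * ascWeight q a a)) (circleMap 0 1 (ρ * Real.log q)) := by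
    intro ρ
    rw [Qpoly_eq hq0, Qpoly_eq hq0, cInv_eq hq0]
    simp only [Pi.mul_apply, ← ha_def]
    ring
  simp_rw [hρ]
  rw [intervalIntegral.integral_const_mul, hI, h2n]
  change _ * (_ * (angleIntegral
    (fun z ↦ ascPoly q a m z * (ascPoly q a k z * ascWeight q a a z)) / _)) = _
  by_cases hkm : k = m
  · subst hkm
    have hpi : (Real.pi : ℂ) ≠ 0 := by exact_mod_cast Real.pi_ne_zero
    have n1 := qpochC_ne_zero hq0 hq1 haa k
    have n2 := qpochCInf_ne_zero hq0 hq1 haa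
    have hs := norm_sq_lt_one hq0 hq1
    have n3 := qpochCInf_ne_zero hq0 hq1 hs
    have n4 : qpochC q ((q : ℂ) ^ (2 * k + 2)) (n - 1) ≠ 0 := by
      have := norm_mul_pow_lt_one hq0 hq1 hs (2 * k)
      rw [← pow_add, add_comm] at this
      exact qpochC_ne_zero hq0 hq1 this _
    have hlog : (Real.log ((q ^ 2)⁻¹) : ℂ) ≠ 0 := by
      rw [Real.log_inv, Real.log_pow]
      have := (Real.log_neg hq0 hq1).ne
      exact_mod_cast (by simpa using this)
    have hsplit : qpochCInf q (a * a) * qpochC q ((q : ℂ) ^ 2) k *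
        qpochC q ((q : ℂ) ^ (2 * k + 2)) (n - 1) =
        qpochCInf q ((q : ℂ) ^ 2) * qpochC q (a * a) k := by
      have e1 : (q : ℂ) ^ (2 * k + 2) = (q : ℂ) ^ 2 * (q : ℂ) ^ (2 * k) := by ring
      have e2 : (q : ℂ) ^ 2 * (q : ℂ) ^ (2 * (n - 1)) = a * a := by
        rw [← h2n, ← pow_add]; congr 1; omega
      rw [mul_assoc, e1, ← qpochC_add, add_comm, qpochC_add, e2,
        qpochCInf_eq_mul hq0 hq1 ((q : ℂ) ^ 2) (n - 1), e2]
      ring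
    rw [angleIntegral_ascPoly_self hq0 hq1 ha, angleIntegral_ascWeight hq0 hq1 ha ha, if_pos rfl,
      show (q : ℂ) ^ (n * k) = a ^ k by rw [ha_def, pow_mul], pow_mul']
    have hak : a ^ k ≠ 0 := pow_ne_zero _ ha0
    generalize qpochC q (a * a) k = x at *
    generalize qpochC q ((q : ℂ) ^ 2) k = y at *
    generalize qpochCInf q (a * a) = X at *
    generalize qpochCInf q ((q : ℂ) ^ 2) = Y at *
    generalize qpochC q ((q : ℂ) ^ (2 * k + 2)) (n - 1) = w at *
    generalize (Real.log ((q ^ 2)⁻¹) : ℂ) = h at *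
    generalize a ^ k = u at *
    push_cast
    field_simp
    linear_combination hsplit
  · rw [angleIntegral_ascPoly_of_ne hq0 hq1 ha hkm, if_neg hkm]
    simp
end

section
/- For every integer j ≥ 0 and every ρ ∈ ℝ: p_j(λ(ρ)) = φ_ρ(q^{2j}), where p_j is the explicit polynomial appearing in the asymptotic expansion of the q-Berezin transform and λ(ρ) = −q^{2−2n}(1 − q^{n+iρ})(1 − q^{n−iρ})/(1 − q²)². -/
/-- `λ(ρ) = −q^{2−2n} (1 − q^{n+iρ})(1 − q^{n−iρ}) / (1 − q²)²`. -/
noncomputable def sphLam (q : ℝ) (n : ℕ) (ρ : ℝ) : ℂ :=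
  -(q : ℂ) ^ ((2 : ℤ) - 2 * n) * (1 - qcpow q ((n : ℂ) + ρ * Complex.I)) *
    (1 - qcpow q ((n : ℂ) - ρ * Complex.I)) / (1 - (q : ℂ) ^ 2) ^ 2

/-- The polynomial `p_j(x) = Σ_{l=0}^{j} (q^{−2j};q²)_l q^{2l} / ((q^{2n};q²)_l (q²;q²)_l)
  · ∏_{m=0}^{l−1} [(1 − q^{2m})(1 − q^{2m+2n}) − q^{2m+2n−2}(1 − q²)² x]` from the asymptotic
expansion of the q-Berezin transform. -/
noncomputable def pBer (q : ℝ) (n j : ℕ) (x : ℂ) : ℂ :=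
  ∑ l ∈ Finset.range (j + 1),
    qpochC q (((q : ℂ) ^ (2 * j))⁻¹) l * (q : ℂ) ^ (2 * l) /
      (qpochC q ((q : ℂ) ^ (2 * n)) l * qpochC q ((q : ℂ) ^ 2) l) *
      ∏ m ∈ Finset.range l,
        ((1 - (q : ℂ) ^ (2 * m)) * (1 - (q : ℂ) ^ (2 * m + 2 * n)) -
          (q : ℂ) ^ (2 * m + 2 * n - 2) * (1 - (q : ℂ) ^ 2) ^ 2 * x)

/-- `q^{n+z} q^{n-z} = q^{2n}`. -/
lemma qcpow_add_mul_qcpow_sub {q : ℝ} (hq : 0 < q) (n : ℕ) (z : ℂ) :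
    qcpow q (n + z) * qcpow q (n - z) = (q : ℂ) ^ (2 * n) := by
  have h : Complex.exp (Real.log q : ℂ) = q := by
    rw [← Complex.ofReal_exp, Real.exp_log hq]
  rw [qcpow, qcpow, ← Complex.exp_add, ← h, ← Complex.exp_nat_mul]
  congr 1
  push_cast
  ring

/-- Each factor of the product in `pBer`, evaluated at `sphLam`, splits into the corresponding
factors of the two shifted factorials in `sphPhi`. -/
lemma pBer_factor_sphLam {q : ℝ} (hq0 : 0 < q) (hq1 : q < 1) {n : ℕ} (hn : 1 ≤ n)
    (ρ : ℝ) (m : ℕ) :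
    (1 - (q : ℂ) ^ (2 * m)) * (1 - (q : ℂ) ^ (2 * m + 2 * n)) -
        (q : ℂ) ^ (2 * m + 2 * n - 2) * (1 - (q : ℂ) ^ 2) ^ 2 * sphLam q n ρ =
      (1 - qcpow q ((n : ℂ) + ρ * Complex.I) * (q : ℂ) ^ (2 * m)) *
        (1 - qcpow q ((n : ℂ) - ρ * Complex.I) * (q : ℂ) ^ (2 * m)) := by
  have hq : (q : ℂ) ≠ 0 := by exact_mod_cast hq0.ne'
  have hq2 : (1 - (q : ℂ) ^ 2) ^ 2 ≠ 0 := by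
    have : (1 - q ^ 2) ^ 2 ≠ 0 := pow_ne_zero _ (by nlinarith)
    exact_mod_cast this
  have hAB := qcpow_add_mul_qcpow_sub hq0 n (ρ * Complex.I)
  have hpow : (q : ℂ) ^ (2 * m + 2 * n - 2) * (q : ℂ) ^ ((2 : ℤ) - 2 * n) =
      (q : ℂ) ^ (2 * m) := by
    rw [← zpow_natCast, ← zpow_add₀ hq, ← zpow_natCast]
    congr 1
    omega
  unfold sphLam
  set A := qcpow q ((n : ℂ) + ρ * Complex.I)
  set B := qcpow q ((n : ℂ) - ρ * Complex.I)
  have hlam : (q : ℂ) ^ (2 * m + 2 * n - 2) * (1 - (q : ℂ) ^ 2) ^ 2 *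
      (-(q : ℂ) ^ ((2 : ℤ) - 2 * n) * (1 - A) * (1 - B) / (1 - (q : ℂ) ^ 2) ^ 2) =
      -((q : ℂ) ^ (2 * m) * (1 - A) * (1 - B)) := by
    rw [mul_assoc, mul_div_cancel₀ _ hq2, ← hpow]
    ring
  rw [hlam, pow_add, ← hAB]
  ring

/-- `p_j(λ(ρ)) = φ_ρ(q^{2j})`. -/
theorem statement9 (q : ℝ) (hq0 : 0 < q) (hq1 : q < 1) (n : ℕ) (hn : 1 ≤ n)
    (j : ℕ) (ρ : ℝ) :
    pBer q n j (sphLam q n ρ) = sphPhi q n ρ j := by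
  unfold pBer sphPhi
  refine Finset.sum_congr rfl fun l _ => ?_
  have hprod := Finset.prod_congr (rfl : Finset.range l = Finset.range l)
    fun m _ => pBer_factor_sphLam hq0 hq1 hn ρ m
  rw [hprod, Finset.prod_mul_distrib]
  unfold qpochC
  ring
end

section
/- For all integers j, k ≥ 0, the function t ↦ (B_{q,t} f_k)(q^{2j}) given by the explicit finite sum is a polynomial in t; its value at t = 0 is δ_{jk}; and its derivative at t = 0 equals q^{2n+2}/(1−q²) times: (1 − q^{2k+2}) if j = k+1; −(1 + q^{−2n} − 2q^{2k}) if j = k; (q^{−2n} − q^{2k−2}) if j = k−1; and 0 otherwise. Equivalently, the q-Laplace–Beltrami operator Δ_{n,q} = (q^{−2n}/(1−q²)) · d/dt|_{t=0} B_{q,t} acts on the delta functions f_k by the Jacobi (tridiagonal) form Δ_{n,q} f_k = q²/(1−q²)² · [(1−q^{2k+2}) f_{k+1} − (1+q^{−2n}−2q^{2k}) f_k + (q^{−2n}−q^{2k−2}) f_{k−1}] (Proposition 4.2). -/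
/-- The q²-shifted factorial `(a; q²)_m = ∏_{j=0}^{m-1} (1 − a q^{2j})`. -/
noncomputable def qpochR (q a : ℝ) (m : ℕ) : ℝ :=
  ∏ j ∈ Finset.range m, (1 - a * q ^ (2 * j))

/-- The radial q-Berezin transform of the delta function `f_k`, evaluated at `q^{2j}`:
`(B_{q,t} f_k)(q^{2j}) = t^{k+j} q^{2k} q^{2j(n+1)} Σ_{m=0}^{min(j,k)} t^{−2m} q^{−4m−2mn}
 (tq²;q²)_{n+m} (q^{2k−2m+2};q²)_{n+m−1} (tq^{2n+2};q²)_m (q^{2j−2m+2};q²)_m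
 / [(q²;q²)_{n+m−1} (q²;q²)_m]`. -/
noncomputable def Brad (q t : ℝ) (n k j : ℕ) : ℝ :=
  t ^ (k + j) * q ^ (2 * k) * q ^ (2 * j * (n + 1)) *
    ∑ m ∈ Finset.range (min j k + 1),
      (t ^ (2 * m))⁻¹ * (q ^ (4 * m + 2 * m * n))⁻¹ * qpochR q (t * q ^ 2) (n + m) *
        qpochR q (q ^ (2 * k - 2 * m + 2)) (n + m - 1) * qpochR q (t * q ^ (2 * n + 2)) m *
        qpochR q (q ^ (2 * j - 2 * m + 2)) m /
        (qpochR q (q ^ 2) (n + m - 1) * qpochR q (q ^ 2) m)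

open Polynomial in
/-- The polynomial in `t` whose value is `(t a; q²)_m`. -/
noncomputable def qpochPoly (q a : ℝ) (m : ℕ) : ℝ[X] :=
  ∏ j ∈ Finset.range m, (1 - C (a * q ^ (2 * j)) * X)

theorem qpochPoly_eval (q a t : ℝ) (m : ℕ) : (qpochPoly q a m).eval t = qpochR q (t * a) m := by
  simp only [qpochPoly, qpochR, Polynomial.eval_prod]
  refine Finset.prod_congr rfl fun i _ => ?_
  simp
  ring

theorem qpochPoly_eval_zero (q a : ℝ) (m : ℕ) : (qpochPoly q a m).eval 0 = 1 := by
  simp [qpochPoly_eval, qpochR]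

theorem qpochPoly_derivative_eval_zero (q a : ℝ) (hq : 1 - q ^ 2 ≠ 0) (m : ℕ) :
    (qpochPoly q a m).derivative.eval 0 = -a * (1 - q ^ (2 * m)) / (1 - q ^ 2) := by
  induction m with
  | zero => simp [qpochPoly]
  | succ m ih =>
    have h : qpochPoly q a (m + 1) =
        qpochPoly q a m * (1 - Polynomial.C (a * q ^ (2 * m)) * Polynomial.X) :=
      Finset.prod_range_succ _ _
    rw [h, Polynomial.derivative_mul, Polynomial.eval_add, Polynomial.eval_mul,
      Polynomial.eval_mul, ih, qpochPoly_eval_zero]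
    simp
    field_simp
    ring

theorem one_sub_pow_ne_zero_of_lt_one {q : ℝ} (hq0 : 0 < q) (hq1 : q < 1) {m : ℕ} (hm : m ≠ 0) :
    1 - q ^ m ≠ 0 :=
  (sub_pos.2 (pow_lt_one₀ hq0.le hq1 hm)).ne'

theorem qpochR_sq_ne_zero {q : ℝ} (hq0 : 0 < q) (hq1 : q < 1) (m : ℕ) :
    qpochR q (q ^ 2) m ≠ 0 := by
  refine Finset.prod_ne_zero_iff.2 fun i _ => ?_
  rw [← pow_add]
  exact one_sub_pow_ne_zero_of_lt_one hq0 hq1 (by omega)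

theorem qpochR_shift (q : ℝ) (m : ℕ) :
    (1 - q ^ 2) * qpochR q (q ^ 4) m = (1 - q ^ (2 * m + 2)) * qpochR q (q ^ 2) m := by
  induction m with
  | zero => simp [qpochR]
  | succ m ih =>
    have h (a : ℝ) : qpochR q a (m + 1) = qpochR q a m * (1 - a * q ^ (2 * m)) :=
      Finset.prod_range_succ _ _
    rw [h, h, ← mul_assoc, ih]
    ring

/-- The `t`-independent factor of the `m`-th summand of `Brad`. -/
noncomputable def bradCoeff (q : ℝ) (n k j m : ℕ) : ℝ :=
  q ^ (2 * k) * q ^ (2 * j * (n + 1)) * (q ^ (4 * m + 2 * m * n))⁻¹ *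
    qpochR q (q ^ (2 * k - 2 * m + 2)) (n + m - 1) * qpochR q (q ^ (2 * j - 2 * m + 2)) m /
    (qpochR q (q ^ 2) (n + m - 1) * qpochR q (q ^ 2) m)

open Polynomial in
/-- The `m`-th summand of `Brad`, with `t ^ (k + j - 2 * m)` replaced by `t ^ e`, as a polynomial
in `t`. -/
noncomputable def bradTerm (q : ℝ) (n k j m e : ℕ) : ℝ[X] :=
  C (bradCoeff q n k j m) * X ^ e *
    (qpochPoly q (q ^ 2) (n + m) * qpochPoly q (q ^ (2 * n + 2)) m)

theorem brad_eq_eval (q t : ℝ) (ht : t ≠ 0) (n k j : ℕ) :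
    Brad q t n k j =
      (∑ m ∈ Finset.range (min j k + 1), bradTerm q n k j m (k + j - 2 * m)).eval t := by
  rw [Polynomial.eval_finsetSum, Brad, Finset.mul_sum]
  refine Finset.sum_congr rfl fun m hm => ?_
  have hm' : 2 * m ≤ k + j := by
    have := Finset.mem_range.1 hm
    omega
  simp only [bradTerm, bradCoeff, Polynomial.eval_mul, Polynomial.eval_C, Polynomial.eval_pow,
    Polynomial.eval_X, qpochPoly_eval, pow_sub₀ t ht hm']
  ring

theorem bradTerm_eval_zero (q : ℝ) (n k j m e : ℕ) :
    (bradTerm q n k j m e).eval 0 = bradCoeff q n k j m * 0 ^ e := by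
  simp [bradTerm, qpochPoly_eval_zero]

theorem bradTerm_derivative_eval_zero (q : ℝ) (hq : 1 - q ^ 2 ≠ 0) (n k j m e : ℕ) :
    (bradTerm q n k j m e).derivative.eval 0 = bradCoeff q n k j m *
      (e * 0 ^ (e - 1) - 0 ^ e * (q ^ 2 * (1 - q ^ (2 * (n + m))) +
        q ^ (2 * n + 2) * (1 - q ^ (2 * m))) / (1 - q ^ 2)) := by
  simp [bradTerm, Polynomial.derivative_mul, Polynomial.derivative_X_pow, qpochPoly_eval_zero,
    qpochPoly_derivative_eval_zero q _ hq]
  ring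

theorem sum_bradTerm_eval_zero (q : ℝ) (n k j : ℕ) :
    (∑ m ∈ Finset.range (min j k + 1), bradTerm q n k j m (k + j - 2 * m)).eval 0 =
      (bradTerm q n k j (min j k) (k + j - 2 * min j k)).eval 0 := by
  rw [Polynomial.eval_finsetSum, Finset.sum_range_succ, add_eq_right]
  refine Finset.sum_eq_zero fun m hm => ?_
  have := Finset.mem_range.1 hm
  rw [bradTerm_eval_zero, zero_pow (by omega), mul_zero]

theorem sum_bradTerm_derivative_eval_zero (q : ℝ) (hq : 1 - q ^ 2 ≠ 0) (n k j : ℕ) :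
    (∑ m ∈ Finset.range (min j k + 1), bradTerm q n k j m (k + j - 2 * m)).derivative.eval 0 =
      (bradTerm q n k j (min j k) (k + j - 2 * min j k)).derivative.eval 0 := by
  rw [Polynomial.derivative_sum, Polynomial.eval_finsetSum, Finset.sum_range_succ, add_eq_right]
  refine Finset.sum_eq_zero fun m hm => ?_
  have := Finset.mem_range.1 hm
  rw [bradTerm_derivative_eval_zero q hq, zero_pow (by omega), zero_pow (by omega)]
  simp

theorem bradCoeff_self {q : ℝ} (hq0 : 0 < q) (hq1 : q < 1) (n k : ℕ) :
    bradCoeff q n k k k = 1 := by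
  have h1 := qpochR_sq_ne_zero hq0 hq1 (n + k - 1)
  have h2 := qpochR_sq_ne_zero hq0 hq1 k
  simp only [bradCoeff, Nat.sub_self, zero_add]
  field_simp
  ring

theorem bradCoeff_succ_left {q : ℝ} (hq0 : 0 < q) (hq1 : q < 1) (n k : ℕ) :
    bradCoeff q n k (k + 1) k = q ^ (2 * n + 2) / (1 - q ^ 2) * (1 - q ^ (2 * k + 2)) := by
  have h1 := qpochR_sq_ne_zero hq0 hq1 (n + k - 1)
  have h2 := qpochR_sq_ne_zero hq0 hq1 k
  have h3 := one_sub_pow_ne_zero_of_lt_one hq0 hq1 two_ne_zero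
  have h4 : qpochR q (q ^ 4) k = (1 - q ^ (2 * k + 2)) * qpochR q (q ^ 2) k / (1 - q ^ 2) := by
    rw [← qpochR_shift]
    field_simp
  have h5 : 2 * (k + 1) - 2 * k + 2 = 4 := by omega
  simp only [bradCoeff, Nat.sub_self, zero_add, h5, h4]
  field_simp
  ring

theorem bradCoeff_succ_right {q : ℝ} (hq0 : 0 < q) (hq1 : q < 1) {n : ℕ} (hn : 1 ≤ n) (j : ℕ) :
    bradCoeff q n (j + 1) j j =
      q ^ (2 * n + 2) / (1 - q ^ 2) * ((q ^ (2 * n))⁻¹ - q ^ (2 * j)) := by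
  obtain ⟨n, rfl⟩ := Nat.exists_eq_add_of_le' hn
  have h1 := qpochR_sq_ne_zero hq0 hq1 (n + j)
  have h2 := qpochR_sq_ne_zero hq0 hq1 j
  have h3 := one_sub_pow_ne_zero_of_lt_one hq0 hq1 two_ne_zero
  have h4 : qpochR q (q ^ 4) (n + j) =
      (1 - q ^ (2 * (n + j) + 2)) * qpochR q (q ^ 2) (n + j) / (1 - q ^ 2) := by
    rw [← qpochR_shift]
    field_simp
  have h5 : 2 * (j + 1) - 2 * j + 2 = 4 := by omega
  have h6 : n + 1 + j - 1 = n + j := by omega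
  simp only [bradCoeff, Nat.sub_self, zero_add, h5, h6, h4]
  field_simp
  ring

/-- Proposition 4.2: `t ↦ (B_{q,t} f_k)(q^{2j})` is a polynomial in `t`, with value
`δ_{jk}` at `t = 0` and derivative at `t = 0` equal to `q^{2n+2}/(1−q²)` times
`(1−q^{2k+2})` if `j = k+1`, `−(1+q^{−2n}−2q^{2k})` if `j = k`,
`(q^{−2n}−q^{2k−2})` if `j = k−1`, and `0` otherwise. -/
theorem statement11 (q : ℝ) (hq0 : 0 < q) (hq1 : q < 1) (n : ℕ) (hn : 1 ≤ n) (j k : ℕ) :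
    ∃ P : Polynomial ℝ,
      (∀ t : ℝ, 0 < t → t < 1 → Brad q t n k j = P.eval t) ∧
      P.eval 0 = (if j = k then 1 else 0) ∧
      P.derivative.eval 0 = q ^ (2 * n + 2) / (1 - q ^ 2) *
        (if j = k + 1 then 1 - q ^ (2 * k + 2)
         else if j = k then -(1 + (q ^ (2 * n))⁻¹ - 2 * q ^ (2 * k))
         else if j + 1 = k then (q ^ (2 * n))⁻¹ - q ^ (2 * k - 2)
         else 0) := by
  have hq := one_sub_pow_ne_zero_of_lt_one hq0 hq1 two_ne_zero
  refine ⟨_, fun t ht _ => brad_eq_eval q t ht.ne' n k j, ?_, ?_⟩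
  · rw [sum_bradTerm_eval_zero, bradTerm_eval_zero]
    split_ifs with h
    · subst h
      have h0 : j + j - 2 * min j j = 0 := by omega
      rw [h0, min_self, bradCoeff_self hq0 hq1, pow_zero, mul_one]
    · rw [zero_pow (by omega), mul_zero]
  · rw [sum_bradTerm_derivative_eval_zero q hq, bradTerm_derivative_eval_zero q hq]
    split_ifs with h1 h2 h3
    · subst h1
      have h0 : k + (k + 1) - 2 * min (k + 1) k = 1 := by omega
      rw [h0, min_eq_right (by omega), bradCoeff_succ_left hq0 hq1]
      simp
    · subst h2
      have h0 : j + j - 2 * min j j = 0 := by omega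
      rw [h0, min_self, bradCoeff_self hq0 hq1]
      field_simp
      ring
    · subst h3
      have h0 : j + 1 + j - 2 * min j (j + 1) = 1 := by omega
      rw [h0, min_eq_left (by omega), bradCoeff_succ_right hq0 hq1 hn]
      simp [Nat.mul_succ]
    · rw [zero_pow (by omega), zero_pow (by omega)]
      simp
end

section
/- For every t = q^{2α} ∈ (0,1) and every ρ ∈ ℝ, the Berezin symbol b_{q,α}(ρ) is a real number and satisfies (tq²;q²)_∞ (tq^{2n+2};q²)_∞ / ((−tq^{n+2};q²)_∞)² ≤ b_{q,α}(ρ) ≤ (tq²;q²)_∞ (tq^{2n+2};q²)_∞ / ((tq^{n+2};q²)_∞)². In particular b_{q,α} is bounded and bounded below by a positive constant, so multiplication by b_{q,α} (and hence the radial q-Berezin transform) is a bounded invertible operator. -/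
/-- The infinite q²-shifted factorial `(a; q²)_∞` (real). -/
noncomputable def qpochRInf (q a : ℝ) : ℝ :=
  ∏' j : ℕ, (1 - a * q ^ (2 * j))

/-- The Berezin symbol `b_{q,α}(ρ)`, `t = q^{2α}`. -/
noncomputable def bSym (q t : ℝ) (n : ℕ) (ρ : ℝ) : ℂ :=
  qpochCInf q ((t : ℂ) * (q : ℂ) ^ 2) * qpochCInf q ((t : ℂ) * (q : ℂ) ^ (2 * n + 2)) /
    (qpochCInf q ((t : ℂ) * qcpow q (((n : ℕ) : ℂ) + 2 + ρ * Complex.I)) *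
      qpochCInf q ((t : ℂ) * qcpow q (((n : ℕ) : ℂ) + 2 - ρ * Complex.I)))

lemma multipliable_one_sub_mul_qpow {q : ℝ} (hq0 : 0 < q) (hq1 : q < 1) (a : ℂ) :
    Multipliable fun j : ℕ ↦ 1 - a * (q : ℂ) ^ (2 * j) := by
  have hs : Summable fun j : ℕ ↦ ‖-(a * (q : ℂ) ^ (2 * j))‖ := by
    have h2 : q ^ 2 < 1 := by nlinarith
    refine ((summable_geometric_of_lt_one (sq_nonneg q) h2).mul_left ‖a‖).congr fun j ↦ ?_
    simp [pow_mul, abs_of_pos hq0]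
  simpa only [sub_eq_add_neg] using multipliable_one_add_of_summable hs

lemma summable_mul_qpow {q : ℝ} (hq0 : 0 < q) (hq1 : q < 1) (a : ℝ) :
    Summable fun j : ℕ ↦ ‖-(a * q ^ (2 * j))‖ := by
  have h2 : q ^ 2 < 1 := by nlinarith
  refine ((summable_geometric_of_lt_one (sq_nonneg q) h2).mul_left |a|).congr fun j ↦ ?_
  simp [pow_mul, abs_of_pos hq0]

lemma multipliable_one_sub_mul_qpow_real {q : ℝ} (hq0 : 0 < q) (hq1 : q < 1) (a : ℝ) :
    Multipliable fun j : ℕ ↦ 1 - a * q ^ (2 * j) := by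
  simpa only [sub_eq_add_neg] using
    multipliable_one_add_of_summable (summable_mul_qpow hq0 hq1 a)

lemma qpochCInf_ofReal {q : ℝ} (hq0 : 0 < q) (hq1 : q < 1) (a : ℝ) :
    qpochCInf q (a : ℂ) = (qpochRInf q a : ℂ) := by
  have h := (multipliable_one_sub_mul_qpow_real hq0 hq1 a).map_tprod Complex.ofRealHom
    Complex.continuous_ofReal
  simp only [Complex.ofRealHom_eq_coe] at h
  rw [qpochRInf, qpochCInf, h]
  push_cast
  rfl

lemma qpochCInf_conj {q : ℝ} (hq0 : 0 < q) (hq1 : q < 1) (a : ℂ) :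
    qpochCInf q ((starRingEnd ℂ) a) = (starRingEnd ℂ) (qpochCInf q a) := by
  have h := (multipliable_one_sub_mul_qpow hq0 hq1 a).map_tprod (starRingEnd ℂ)
    Complex.continuous_conj
  rw [qpochCInf, qpochCInf, h]
  simp

lemma mul_qpow_lt_one {q a : ℝ} (hq0 : 0 < q) (hq1 : q < 1) (ha : a < 1) (j : ℕ) :
    a * q ^ (2 * j) < 1 := by
  have h0 : 0 < q ^ (2 * j) := by positivity
  have h1 : q ^ (2 * j) ≤ 1 := pow_le_one₀ hq0.le hq1.le
  nlinarith

lemma qpochRInf_pos {q a : ℝ} (hq0 : 0 < q) (hq1 : q < 1) (ha : a < 1) :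
    0 < qpochRInf q a := by
  refine lt_of_le_of_ne ?_ (Ne.symm ?_)
  · refine ge_of_tendsto' (multipliable_one_sub_mul_qpow_real hq0 hq1 a).hasProd.tendsto_prod_nat
      fun N ↦ Finset.prod_nonneg fun j _ ↦ ?_
    exact (sub_pos.2 (mul_qpow_lt_one hq0 hq1 ha j)).le
  · simp only [qpochRInf, sub_eq_add_neg]
    refine tprod_one_add_ne_zero_of_summable (fun j ↦ ?_) (summable_mul_qpow hq0 hq1 a)
    rw [← sub_eq_add_neg]
    exact (sub_pos.2 (mul_qpow_lt_one hq0 hq1 ha j)).ne'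

lemma qpochRInf_norm_le_norm_qpochCInf {q : ℝ} (hq0 : 0 < q) (hq1 : q < 1) {a : ℂ}
    (ha : ‖a‖ < 1) : qpochRInf q ‖a‖ ≤ ‖qpochCInf q a‖ := by
  refine le_of_tendsto_of_tendsto'
    (multipliable_one_sub_mul_qpow_real hq0 hq1 ‖a‖).hasProd.tendsto_prod_nat
    (multipliable_one_sub_mul_qpow hq0 hq1 a).hasProd.norm.tendsto_prod_nat
    fun N ↦ Finset.prod_le_prod (fun j _ ↦ ?_) fun j _ ↦ ?_
  · exact (sub_pos.2 (mul_qpow_lt_one hq0 hq1 ha j)).le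
  · simpa [abs_of_pos hq0] using norm_sub_norm_le (1 : ℂ) (a * (q : ℂ) ^ (2 * j))

lemma norm_qpochCInf_le_qpochRInf_neg_norm {q : ℝ} (hq0 : 0 < q) (hq1 : q < 1) (a : ℂ) :
    ‖qpochCInf q a‖ ≤ qpochRInf q (-‖a‖) := by
  refine le_of_tendsto_of_tendsto'
    (multipliable_one_sub_mul_qpow hq0 hq1 a).hasProd.norm.tendsto_prod_nat
    (multipliable_one_sub_mul_qpow_real hq0 hq1 (-‖a‖)).hasProd.tendsto_prod_nat
    fun N ↦ Finset.prod_le_prod (fun j _ ↦ norm_nonneg _) fun j _ ↦ ?_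
  simpa [abs_of_pos hq0] using norm_sub_le (1 : ℂ) (a * (q : ℂ) ^ (2 * j))

lemma norm_qcpow {q : ℝ} (hq0 : 0 < q) (n : ℕ) (ρ : ℝ) :
    ‖qcpow q (((n : ℕ) : ℂ) + 2 + ρ * Complex.I)‖ = q ^ (n + 2) := by
  rw [qcpow, Complex.norm_exp, Complex.re_mul_ofReal, ← Real.rpow_natCast,
    Real.rpow_def_of_pos hq0]
  simp [mul_comm]

lemma qcpow_conj (q : ℝ) (z : ℂ) :
    qcpow q ((starRingEnd ℂ) z) = (starRingEnd ℂ) (qcpow q z) := by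
  rw [qcpow, qcpow, ← Complex.exp_conj, map_mul, Complex.conj_ofReal]

/-- The Berezin symbol `b_{q,α}(ρ)` is real and satisfies
`(tq²;q²)_∞ (tq^{2n+2};q²)_∞ / ((−tq^{n+2};q²)_∞)² ≤ b_{q,α}(ρ)
  ≤ (tq²;q²)_∞ (tq^{2n+2};q²)_∞ / ((tq^{n+2};q²)_∞)²`. -/
theorem statement13 (q : ℝ) (hq0 : 0 < q) (hq1 : q < 1) (n : ℕ) (hn : 1 ≤ n)
    (t : ℝ) (ht0 : 0 < t) (ht1 : t < 1) (ρ : ℝ) :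
    (bSym q t n ρ).im = 0 ∧
    qpochRInf q (t * q ^ 2) * qpochRInf q (t * q ^ (2 * n + 2)) /
        (qpochRInf q (-(t * q ^ (n + 2)))) ^ 2 ≤ (bSym q t n ρ).re ∧
    (bSym q t n ρ).re ≤ qpochRInf q (t * q ^ 2) * qpochRInf q (t * q ^ (2 * n + 2)) /
        (qpochRInf q (t * q ^ (n + 2))) ^ 2 := by
  set c : ℂ := (t : ℂ) * qcpow q (((n : ℕ) : ℂ) + 2 + ρ * Complex.I) with hc
  have hcn : ‖c‖ = t * q ^ (n + 2) := by
    rw [hc, norm_mul, norm_qcpow hq0, Complex.norm_of_nonneg ht0.le]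
  have hlt : ∀ m : ℕ, t * q ^ m < 1 := fun m ↦ by
    have h0 : 0 < q ^ m := by positivity
    have h1 : q ^ m ≤ 1 := pow_le_one₀ hq0.le hq1.le
    nlinarith
  have hcc : (t : ℂ) * qcpow q (((n : ℕ) : ℂ) + 2 - ρ * Complex.I) = (starRingEnd ℂ) c := by
    rw [hc, map_mul, ← qcpow_conj]
    simp [sub_eq_add_neg, map_ofNat]
  have hb : bSym q t n ρ = ((qpochRInf q (t * q ^ 2) * qpochRInf q (t * q ^ (2 * n + 2)) /
      ‖qpochCInf q c‖ ^ 2 : ℝ) : ℂ) := by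
    rw [bSym, hcc, ← hc, qpochCInf_conj hq0 hq1, Complex.mul_conj, Complex.normSq_eq_norm_sq]
    push_cast
    rw [← qpochCInf_ofReal hq0 hq1, ← qpochCInf_ofReal hq0 hq1]
    push_cast
    rfl
  have hlow := qpochRInf_norm_le_norm_qpochCInf hq0 hq1 (hcn ▸ hlt (n + 2))
  have hupp := norm_qpochCInf_le_qpochRInf_neg_norm hq0 hq1 c
  rw [hcn] at hlow hupp
  have hpos := qpochRInf_pos hq0 hq1 (hlt (n + 2))
  have hnum : 0 ≤ qpochRInf q (t * q ^ 2) * qpochRInf q (t * q ^ (2 * n + 2)) :=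
    (mul_pos (qpochRInf_pos hq0 hq1 (hlt _)) (qpochRInf_pos hq0 hq1 (hlt _))).le
  have hP := hpos.trans_le hlow
  rw [hb, Complex.ofReal_re, Complex.ofReal_im]
  refine ⟨rfl, ?_, ?_⟩ <;> gcongr
end
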